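/- arXiv:1909.11168 — 2 statements merged into one kernel-verified Lean document; each statement's English description precedes it below -/
import Mathlib

section
/- (Non-invariance of Temam's extra force under Galilean changes of observer.) Let v : ℝ³ × ℝ → ℝ³ be differentiable, w ∈ ℝ³, τ ∈ ℝ, and define v*(y,s) = v(y − w(s − τ), s − τ) + w. Then for all (x,t), with x* = x + w t and t* = t + τ, the transformed Temam term satisfies (∇*·v*)(x*,t*) v*(x*,t*) = (∇·v)(x,t) (v(x,t) + w). In particular, there exist a differentiable field v (e.g. v(x,t) = x), a vector w ≠ 0, and a point (x,t) such that (∇*·v*)(x*,t*) v*(x*,t*) ≠ (∇·v)(x,t) v(x,t); hence the extra force density −(1/2)(∇·v)v is not invariant under Galilean changes of observer. -/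
open scoped RealInnerProductSpace BigOperators

noncomputable section

/-- ℝ³ as a Euclidean space. -/
abbrev E3 : Type := EuclideanSpace ℝ (Fin 3)

/-- Spatial divergence `∇·v` of a vector field. -/
def div3 (v : E3 → ℝ → E3) (x : E3) (t : ℝ) : ℝ :=
  ∑ i, (fderiv ℝ (fun y => v y t) x (EuclideanSpace.single i 1)) i

/-- The Galilean transform of a velocity field: `v*(x + w t, t + τ) = v(x,t) + w`. -/
def galTransform (v : E3 → ℝ → E3) (w : E3) (τ : ℝ) : E3 → ℝ → E3 :=
  fun y s => v (y - (s - τ) • w) (s - τ) + w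

theorem galTransform_at (v : E3 → ℝ → E3) (w : E3) (τ : ℝ) (x : E3) (t : ℝ) :
    galTransform v w τ (x + t • w) (t + τ) = v x t + w := by
  simp [galTransform]

theorem div3_galTransform (v : E3 → ℝ → E3) (w : E3) (τ : ℝ) (x : E3) (t : ℝ) :
    div3 (galTransform v w τ) (x + t • w) (t + τ) = div3 v x t := by
  have h : fderiv ℝ (fun y => galTransform v w τ y (t + τ)) (x + t • w)
      = fderiv ℝ (fun y => v y t) x := by
    simp only [galTransform, add_sub_cancel_right, fderiv_add_const]
    rw [fderiv_comp_sub (f := fun y => v y t) (t • w)]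
    simp
  simp only [div3, h]

/-- Temam's extra force density `−(1/2)(∇·v)v` is not invariant under Galilean
changes of observer: the transformed term equals `(∇·v)(v + w)`, and in general
this differs from `(∇·v)v`. -/
theorem temam_extra_force_not_galilean_invariant :
    (∀ (v : E3 → ℝ → E3), Differentiable ℝ (fun q : E3 × ℝ => v q.1 q.2) →
      ∀ (w : E3) (τ : ℝ) (x : E3) (t : ℝ),
        div3 (galTransform v w τ) (x + t • w) (t + τ) •
            galTransform v w τ (x + t • w) (t + τ) =
          div3 v x t • (v x t + w)) ∧
    (∃ (v : E3 → ℝ → E3) (w : E3) (τ : ℝ) (x : E3) (t : ℝ),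
      Differentiable ℝ (fun q : E3 × ℝ => v q.1 q.2) ∧ w ≠ 0 ∧
        -(1 / 2 : ℝ) • (div3 (galTransform v w τ) (x + t • w) (t + τ) •
            galTransform v w τ (x + t • w) (t + τ)) ≠
          -(1 / 2 : ℝ) • (div3 v x t • v x t)) := by
  refine ⟨fun v _ w τ x t => by rw [div3_galTransform, galTransform_at], ?_⟩
  refine ⟨fun x _ => x, EuclideanSpace.single 0 1, 0, 0, 0, differentiable_fst, ?_, ?_⟩
  · intro h
    have := congrArg (fun u : E3 => u 0) h
    simp at this
  · rw [div3_galTransform, galTransform_at]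
    have hd : div3 (fun x _ => x) 0 0 = 3 := by
      simp [div3]
    rw [hd]
    intro h
    have := congrArg (fun u : E3 => u 0) h
    simp at this
end
end

section
/- (Energy balance for smooth compactly supported solutions.) Let Re > 0 and K > 0 be constants and let v : ℝ³ × ℝ → ℝ³ and p : ℝ³ × ℝ → ℝ be smooth fields, compactly supported in the spatial variable at each time, satisfying ∂v/∂t + (v·∇)v + ∇p − (1/Re)Δv = −(1/2)(∇·v)v and (1/K)∂p/∂t + ∇·v = 0 (i.e. zero body force f = 0). Then for every time t, d/dt ∫_{ℝ³} ( |v|²/2 + p²/(2K) ) dx = −(1/Re) ∫_{ℝ³} |∇v|² dx ≤ 0; in particular the total energy t ↦ ∫_{ℝ³} ( |v|²/2 + p²/(2K) ) dx is nonincreasing. -/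
open scoped RealInnerProductSpace BigOperators
open MeasureTheory

noncomputable section

/-- Componentwise spatial Laplacian `Δv` of a vector field. -/
def lap3 (v : E3 → ℝ → E3) (x : E3) (t : ℝ) : E3 :=
  ∑ j, fderiv ℝ (fun y => fderiv ℝ (fun z => v z t) y (EuclideanSpace.single j 1)) x
      (EuclideanSpace.single j 1)

/-- Spatial gradient of a scalar field, as a vector. -/
def grad3 (p : E3 → ℝ → ℝ) (x : E3) (t : ℝ) : E3 :=
  gradient (fun y => p y t) x

/-- Squared Frobenius (Hilbert–Schmidt) norm of a linear map on ℝ³. -/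
def frobSq (L : E3 →L[ℝ] E3) : ℝ :=
  ∑ i, ∑ j, (L (EuclideanSpace.single j 1) i) ^ 2

namespace QI

/-- Smooth compactly supported functions on space-time. -/
def Sm (u : E3 × ℝ → ℝ) : Prop := ContDiff ℝ (⊤ : ℕ∞) u ∧ HasCompactSupport u

/-- Directional derivative. -/
def Dv (w : E3 × ℝ) (u : E3 × ℝ → ℝ) : E3 × ℝ → ℝ := fun z => fderiv ℝ u z w

/-- time direction -/
def et : E3 × ℝ := (0, 1)
/-- space directions -/
def ex (j : Fin 3) : E3 × ℝ := (EuclideanSpace.single j 1, 0)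

/-- iterated time derivative -/
def Dt (k : ℕ) (u : E3 × ℝ → ℝ) : E3 × ℝ → ℝ := (Dv et)^[k] u

lemma contDiff_Dv {u : E3 × ℝ → ℝ} (hu : ContDiff ℝ (⊤ : ℕ∞) u) (w) :
    ContDiff ℝ (⊤ : ℕ∞) (Dv w u) := by
  unfold Dv
  exact (hu.fderiv_right (m := (⊤ : ℕ∞)) (by simp)).clm_apply contDiff_const

lemma Sm.diff {u} (hu : Sm u) : Differentiable ℝ u := hu.1.differentiable (by simp)
lemma Sm.cont {u} (hu : Sm u) : Continuous u := hu.1.continuous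

lemma Sm.Dv {u} (hu : Sm u) (w) : Sm (Dv w u) := by
  refine ⟨contDiff_Dv hu.1 w, ?_⟩
  exact hu.2.fderiv_apply (𝕜 := ℝ) w

lemma Sm.add {u w} (hu : Sm u) (hw : Sm w) : Sm (fun z => u z + w z) :=
  ⟨hu.1.add hw.1, hu.2.add hw.2⟩
lemma Sm.mul {u w} (hu : Sm u) (hw : Sm w) : Sm (fun z => u z * w z) :=
  ⟨hu.1.mul hw.1, hu.2.mul_right⟩
lemma Sm.const_mul {u} (hu : Sm u) (c : ℝ) : Sm (fun z => c * u z) :=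
  ⟨contDiff_const.mul hu.1, hu.2.mul_left⟩
lemma Sm.zero : Sm (fun _ => 0) := ⟨contDiff_const, HasCompactSupport.zero⟩
lemma Sm.sum {ι : Type*} (s : Finset ι) {u : ι → E3 × ℝ → ℝ} (hu : ∀ i, Sm (u i)) :
    Sm (fun z => ∑ i ∈ s, u i z) := by
  classical
  induction s using Finset.induction_on with
  | empty => simpa using Sm.zero
  | insert a s ha ih => simpa [Finset.sum_insert ha] using (hu a).add ih

lemma Dv_add {u w} (hu : Differentiable ℝ u) (hw : Differentiable ℝ w) (e) :
    Dv e (fun z => u z + w z) = fun z => Dv e u z + Dv e w z := by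
  funext z; simp [Dv, fderiv_fun_add (hu z) (hw z)]
lemma Dv_const_mul {u} (hu : Differentiable ℝ u) (c : ℝ) (e) :
    Dv e (fun z => c * u z) = fun z => c * Dv e u z := by
  funext z; simp [Dv, fderiv_const_mul (hu z)]
lemma Dv_mul {u w} (hu : Differentiable ℝ u) (hw : Differentiable ℝ w) (e) :
    Dv e (fun z => u z * w z) = fun z => Dv e u z * w z + u z * Dv e w z := by
  funext z; simp [Dv, fderiv_fun_mul (hu z) (hw z)]; ring
lemma Dv_sum {ι : Type*} (s : Finset ι) {u : ι → E3 × ℝ → ℝ} (hu : ∀ i, Differentiable ℝ (u i))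
    (e) : Dv e (fun z => ∑ i ∈ s, u i z) = fun z => ∑ i ∈ s, Dv e (u i) z := by
  funext z; simp [Dv, fderiv_fun_sum (fun i _ => hu i z)]

lemma Dv_comm {u : E3 × ℝ → ℝ} (hu : ContDiff ℝ (⊤ : ℕ∞) u) (e f) :
    Dv e (Dv f u) = Dv f (Dv e u) := by
  funext z
  have hd : Differentiable ℝ (fderiv ℝ u) :=
    (hu.fderiv_right (m := (⊤ : ℕ∞)) (by simp)).differentiable (by simp)
  have key : ∀ a b, Dv a (Dv b u) z = fderiv ℝ (fderiv ℝ u) z a b := by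
    intro a b
    have : HasFDerivAt (fun z => fderiv ℝ u z b)
        ((ContinuousLinearMap.apply ℝ ℝ b).comp (fderiv ℝ (fderiv ℝ u) z)) z :=
      (ContinuousLinearMap.apply ℝ ℝ b).hasFDerivAt.comp z (hd z).hasFDerivAt
    show fderiv ℝ (fun z => fderiv ℝ u z b) z a = _
    rw [this.fderiv]; rfl
  rw [key, key]
  have := (hu.contDiffAt (x := z)).isSymmSndFDerivAt (by simp only [minSmoothness_of_isRCLikeNormedField]; exact ENat.LEInfty.out)
  exact this e f

lemma Dt_succ (k u) : Dt (k+1) u = Dv et (Dt k u) := Function.iterate_succ_apply' _ _ _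
lemma Dt_zero (u) : Dt 0 u = u := rfl

lemma contDiff_Dt {u : E3 × ℝ → ℝ} (hu : ContDiff ℝ (⊤ : ℕ∞) u) (k) :
    ContDiff ℝ (⊤ : ℕ∞) (Dt k u) := by
  induction k with
  | zero => simpa [Dt_zero]
  | succ k ih => rw [Dt_succ]; exact contDiff_Dv ih _

lemma Sm.Dt {u} (hu : Sm u) (k) : Sm (Dt k u) := by
  induction k with
  | zero => simpa [Dt_zero]
  | succ k ih => rw [Dt_succ]; exact ih.Dv _

lemma Dt_Dv {u : E3 × ℝ → ℝ} (hu : ContDiff ℝ (⊤ : ℕ∞) u) (k e) :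
    Dt k (Dv e u) = Dv e (Dt k u) := by
  induction k with
  | zero => rfl
  | succ k ih => rw [Dt_succ, ih, Dv_comm (contDiff_Dt hu k), Dt_succ]

lemma Dt_add {u w} (hu : Sm u) (hw : Sm w) (k) :
    Dt k (fun z => u z + w z) = fun z => Dt k u z + Dt k w z := by
  induction k with
  | zero => rfl
  | succ k ih => rw [Dt_succ, ih, Dv_add (hu.Dt k).diff (hw.Dt k).diff, Dt_succ, Dt_succ]
lemma Dt_const_mul {u} (hu : Sm u) (c : ℝ) (k) :
    Dt k (fun z => c * u z) = fun z => c * Dt k u z := by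
  induction k with
  | zero => rfl
  | succ k ih => rw [Dt_succ, ih, Dv_const_mul (hu.Dt k).diff, Dt_succ]
lemma Dt_sum {ι : Type*} (s : Finset ι) {u : ι → E3 × ℝ → ℝ} (hu : ∀ i, Sm (u i)) (k) :
    Dt k (fun z => ∑ i ∈ s, u i z) = fun z => ∑ i ∈ s, Dt k (u i) z := by
  induction k with
  | zero => rfl
  | succ k ih => rw [Dt_succ, ih, Dv_sum s (fun i => ((hu i).Dt k).diff)]; simp only [Dt_succ]

/-- derivative in time along a line -/
lemma hasDerivAt_time {u : E3 × ℝ → ℝ} (hu : Differentiable ℝ u) (x t) :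
    HasDerivAt (fun s => u (x, s)) (Dv et u (x, t)) t := by
  have h1 : HasDerivAt (fun s : ℝ => ((x, s) : E3 × ℝ)) (0, 1) t :=
    (hasDerivAt_const t x).prodMk (hasDerivAt_id t)
  exact (hu (x, t)).hasFDerivAt.comp_hasDerivAt t h1

lemma iteratedDeriv_time {u : E3 × ℝ → ℝ} (hu : ContDiff ℝ (⊤ : ℕ∞) u) (x k) :
    iteratedDeriv k (fun s => u (x, s)) = fun s => Dt k u (x, s) := by
  induction k with
  | zero => simp [Dt_zero]
  | succ k ih =>
    rw [iteratedDeriv_succ, ih]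
    funext s
    rw [Dt_succ]
    exact (hasDerivAt_time ((contDiff_Dt hu k).differentiable (by simp)) x s).deriv

lemma Dt_mul {u w} (hu : Sm u) (hw : Sm w) (k) :
    Dt k (fun z => u z * w z) = fun z => ∑ p ∈ Finset.HasAntidiagonal.antidiagonal k,
      (k.choose p.1 : ℝ) * (Dt p.1 u z * Dt p.2 w z) := by
  funext ⟨x, t⟩
  have hx : ContDiff ℝ (⊤ : ℕ∞) (fun s : ℝ => ((x, s) : E3 × ℝ)) := by fun_prop
  have h := congrFun (iteratedDeriv_time (hu.mul hw).1 x k) t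
  have h1 : ContDiffAt ℝ k (fun s => u (x, s)) t :=
    ((hu.1.comp hx).of_le (by exact_mod_cast le_top)).contDiffAt
  have h2 : ContDiffAt ℝ k (fun s => w (x, s)) t :=
    ((hw.1.comp hx).of_le (by exact_mod_cast le_top)).contDiffAt
  rw [← h]
  rw [iteratedDeriv_fun_mul h1 h2]
  simp only [iteratedDeriv_time hu.1, iteratedDeriv_time hw.1]
  rw [Finset.Nat.sum_antidiagonal_eq_sum_range_succ_mk]
  simp [mul_assoc]

/-- spatial slice derivative -/
lemma hasFDerivAt_space {u : E3 × ℝ → ℝ} (hu : Differentiable ℝ u) (x t) :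
    HasFDerivAt (fun y => u (y, t)) ((fderiv ℝ u (x, t)).comp (ContinuousLinearMap.inl ℝ E3 ℝ)) x := by
  have h1 : HasFDerivAt (fun y : E3 => ((y, t) : E3 × ℝ)) (ContinuousLinearMap.inl ℝ E3 ℝ) x :=
    hasFDerivAt_prodMk_left x t
  exact (hu (x, t)).hasFDerivAt.comp x h1

lemma fderiv_space {u : E3 × ℝ → ℝ} (hu : Differentiable ℝ u) (x t j) :
    fderiv ℝ (fun y => u (y, t)) x (EuclideanSpace.single j 1) = Dv (ex j) u (x, t) := by
  rw [(hasFDerivAt_space hu x t).fderiv]; rfl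

end QI

namespace QI
open scoped FourierTransform

/-- partial (spatial) Fourier transform -/
def F (u : E3 × ℝ → ℝ) (ξ : E3) (t : ℝ) : ℂ := 𝓕 (fun x : E3 => (u (x, t) : ℂ)) ξ

lemma F_eq (u ξ t) : F u ξ t = ∫ x : E3, Real.fourierChar (-⟪x, ξ⟫) • (u (x, t) : ℂ) :=
  Real.fourier_eq _ _

/-- spatial support set -/
def spt (u : E3 × ℝ → ℝ) : Set E3 := Prod.fst '' tsupport u

lemma Sm.spt_compact {u} (hu : Sm u) : IsCompact (spt u) := hu.2.isCompact.image continuous_fst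
lemma eq_zero_of_notMem_spt {u x} (hx : x ∉ spt u) (t) : u (x, t) = 0 := by
  by_contra h
  exact hx ⟨(x, t), subset_tsupport _ h, rfl⟩
lemma Sm.bound {u} (hu : Sm u) : ∃ C, 0 ≤ C ∧ ∀ z, |u z| ≤ C := by
  obtain ⟨C, hC⟩ := hu.2.exists_bound_of_continuous hu.cont
  exact ⟨C, (norm_nonneg _).trans (hC 0), hC⟩

lemma Sm.slice_cont {u} (hu : Sm u) (t) : Continuous fun x => u (x, t) :=
  hu.cont.comp (by fun_prop)
lemma Sm.slice_supp {u} (hu : Sm u) (t) : HasCompactSupport fun x => u (x, t) :=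
  HasCompactSupport.intro hu.spt_compact fun _ hx => eq_zero_of_notMem_spt hx t
lemma Sm.slice_int {u} (hu : Sm u) (t) : Integrable fun x : E3 => u (x, t) :=
  (hu.slice_cont t).integrable_of_hasCompactSupport (hu.slice_supp t)
lemma Sm.slice_diff {u} (hu : Sm u) (t) : Differentiable ℝ fun x => u (x, t) :=
  fun x => (hasFDerivAt_space hu.diff x t).differentiableAt

/-- dominating function -/
lemma Sm.dom {u} (hu : Sm u) : ∃ g : E3 → ℝ, Integrable g ∧ ∀ x t, |u (x, t)| ≤ g x := by
  obtain ⟨C, hC, h⟩ := hu.bound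
  refine ⟨(spt u).indicator fun _ => C, ?_, ?_⟩
  · exact (integrable_indicator_iff hu.spt_compact.measurableSet).2
      (integrableOn_const hu.spt_compact.measure_ne_top)
  · intro x t
    by_cases hx : x ∈ spt u
    · simpa [hx] using h _
    · simp [hx, eq_zero_of_notMem_spt hx t]

lemma F_norm_le (u ξ t) : ‖F u ξ t‖ ≤ ∫ x : E3, |u (x, t)| := by
  rw [F_eq]
  refine (norm_integral_le_integral_norm _).trans (le_of_eq ?_)
  simp [Circle.norm_smul]

lemma Sm.F_bdd {u} (hu : Sm u) : ∃ C, 0 ≤ C ∧ ∀ ξ t, ‖F u ξ t‖ ≤ C := by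
  obtain ⟨g, hg, h⟩ := hu.dom
  have : ∀ ξ t, ‖F u ξ t‖ ≤ ∫ x, g x := fun ξ t =>
    (F_norm_le u ξ t).trans (integral_mono (hu.slice_int t).abs hg fun x => h x t)
  exact ⟨_, (norm_nonneg _).trans (this 0 0), this⟩

lemma Sm.F_cont {u} (hu : Sm u) : Continuous fun z : E3 × ℝ => F u z.1 z.2 := by
  obtain ⟨g, hg, h⟩ := hu.dom
  simp only [F_eq]
  have hc := hu.cont
  refine continuous_of_dominated (bound := g) ?_ ?_ hg ?_
  · intro z
    refine Continuous.aestronglyMeasurable ?_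
    simp only [Circle.smul_def]
    fun_prop
  · intro z
    refine Filter.Eventually.of_forall fun x => ?_
    simpa [Circle.norm_smul] using h x z.2
  · refine Filter.Eventually.of_forall fun x => ?_
    simp only [Circle.smul_def]
    fun_prop

lemma Sm.F_hasDerivAt {u} (hu : Sm u) (ξ t) : HasDerivAt (F u ξ) (F (QI.Dv et u) ξ t) t := by
  obtain ⟨g, hg, h⟩ := (hu.Dv et).dom
  have hc := hu.cont
  have hc' := (hu.Dv et).cont
  have e : F u ξ = fun t => ∫ x : E3, Real.fourierChar (-⟪x, ξ⟫) • (u (x, t) : ℂ) := by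
    funext t; exact F_eq _ _ _
  rw [e, F_eq]
  refine (hasDerivAt_integral_of_dominated_loc_of_deriv_le (bound := g) Filter.univ_mem
    (F' := fun t x => Real.fourierChar (-⟪x, ξ⟫) • ((QI.Dv et u) (x, t) : ℂ))
    ?_ ?_ ?_ ?_ hg ?_).2
  · refine Filter.Eventually.of_forall fun t => Continuous.aestronglyMeasurable ?_
    simp only [Circle.smul_def]
    fun_prop
  · have : Integrable fun x : E3 => (u (x, t) : ℂ) := (hu.slice_int t).ofReal
    simpa using this
  · refine Continuous.aestronglyMeasurable ?_
    simp only [Circle.smul_def]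
    fun_prop
  · refine Filter.Eventually.of_forall fun x t _ => ?_
    simpa [Circle.norm_smul] using h x t
  · refine Filter.Eventually.of_forall fun x t _ => ?_
    simp only [Circle.smul_def]
    exact ((hasDerivAt_time hu.diff x t).ofReal_comp).const_smul
      ((Real.fourierChar (-⟪x, ξ⟫) : Circle) : ℂ)

lemma Sm.F_Dx {u} (hu : Sm u) (j ξ t) :
    F (QI.Dv (ex j) u) ξ t = 2 * Real.pi * Complex.I * (ξ j : ℝ) * F u ξ t := by
  have hf : Integrable fun x : E3 => (u (x, t) : ℂ) := (hu.slice_int t).ofReal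
  have hder : ∀ x, HasFDerivAt (fun x : E3 => (u (x, t) : ℂ))
      (Complex.ofRealCLM.comp (fderiv ℝ (fun x => u (x, t)) x)) x := fun x =>
    Complex.ofRealCLM.hasFDerivAt.comp x (hu.slice_diff t x).hasFDerivAt
  have hfd : fderiv ℝ (fun x : E3 => (u (x, t) : ℂ)) = fun x =>
      Complex.ofRealCLM.comp (fderiv ℝ (fun x => u (x, t)) x) := funext fun x => (hder x).fderiv
  have hc1 : ContDiff ℝ (⊤ : ℕ∞) (fun x : E3 => (u (x, t) : ℂ)) :=
    Complex.ofRealCLM.contDiff.comp (hu.1.comp (by fun_prop))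
  have hs1 : HasCompactSupport (fun x : E3 => (u (x, t) : ℂ)) :=
    (hu.slice_supp t).comp_left (g := fun r : ℝ => (r : ℂ)) (by simp)
  have hi : Integrable (fderiv ℝ (fun x : E3 => (u (x, t) : ℂ))) :=
    (hc1.continuous_fderiv (by simp)).integrable_of_hasCompactSupport (hs1.fderiv ℝ)
  have := Real.fourier_fderiv hf (fun x => (hder x).differentiableAt) hi
  have h2 := congrArg (fun L => L (EuclideanSpace.single j (1:ℝ))) (congrFun this ξ)
  beta_reduce at h2
  rw [Real.fourier_continuousLinearMap_apply hi] at h2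
  have h3 : (fun x => (fderiv ℝ (fun x : E3 => (u (x, t) : ℂ)) x) (EuclideanSpace.single j 1)) =
      fun x => ((QI.Dv (ex j) u (x, t) : ℝ) : ℂ) := by
    funext x
    rw [hfd]
    simp [fderiv_space hu.diff x t j]
  rw [h3] at h2
  unfold F
  rw [h2]
  have h4 : (innerSL ℝ ξ) (EuclideanSpace.single j (1:ℝ)) = ξ j := by
    rw [innerSL_apply_apply, EuclideanSpace.inner_single_right]; simp
  simp [VectorFourier.fourierSMulRight_apply, h4]
  ring

end QI

namespace QI
open scoped FourierTransform

lemma F_int {u} (hu : Sm u) (ξ t) :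
    Integrable fun x : E3 => Real.fourierChar (-⟪x, ξ⟫) • (u (x, t) : ℂ) := by
  have : Integrable fun x : E3 => (u (x, t) : ℂ) := (hu.slice_int t).ofReal
  simpa using this

lemma F_add {u w} (hu : Sm u) (hw : Sm w) (ξ t) :
    F (fun z => u z + w z) ξ t = F u ξ t + F w ξ t := by
  rw [F_eq, F_eq, F_eq, ← integral_add (F_int hu ξ t) (F_int hw ξ t)]
  simp

lemma F_const_mul (u : E3 × ℝ → ℝ) (c : ℝ) (ξ t) :
    F (fun z => c * u z) ξ t = c * F u ξ t := by
  rw [F_eq, F_eq, ← integral_const_mul]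
  congr 1
  funext x
  simp only [Circle.smul_def, smul_eq_mul]
  push_cast; ring

lemma F_zero (ξ t) : F (fun _ => 0) ξ t = 0 := by
  rw [F_eq]; simp

lemma F_sum {ι : Type*} (s : Finset ι) {u : ι → E3 × ℝ → ℝ} (hu : ∀ i, Sm (u i)) (ξ t) :
    F (fun z => ∑ i ∈ s, u i z) ξ t = ∑ i ∈ s, F (u i) ξ t := by
  classical
  induction s using Finset.induction_on with
  | empty => simpa using F_zero ξ t
  | insert a s ha ih =>
    simp only [Finset.sum_insert ha]
    rw [F_add (hu a) (Sm.sum s hu), ih]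

lemma F_congr {u w : E3 × ℝ → ℝ} {t} (h : ∀ x, u (x, t) = w (x, t)) (ξ) : F u ξ t = F w ξ t := by
  simp only [F, h]

/-- spatial Laplacian -/
def Lp (u : E3 × ℝ → ℝ) : E3 × ℝ → ℝ := fun z => ∑ j, Dv (ex j) (Dv (ex j) u) z

lemma Sm.Lp {u} (hu : Sm u) : Sm (Lp u) := Sm.sum _ fun j => (hu.Dv _).Dv _

lemma norm_sq_eq (ξ : E3) : ‖ξ‖ ^ 2 = ∑ j, ξ j ^ 2 := by
  rw [EuclideanSpace.norm_sq_eq]; simp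

lemma Sm.F_Lp {u} (hu : Sm u) (ξ t) :
    F (QI.Lp u) ξ t = -((4 * Real.pi ^ 2 * ‖ξ‖ ^ 2 : ℝ) : ℂ) * F u ξ t := by
  unfold QI.Lp
  rw [F_sum _ (fun j => (hu.Dv _).Dv _), norm_sq_eq]
  push_cast
  rw [Finset.mul_sum, ← Finset.sum_neg_distrib, Finset.sum_mul]
  refine Finset.sum_congr rfl fun j _ => ?_
  rw [(hu.Dv _).F_Dx, hu.F_Dx]
  ring_nf
  simp [Complex.I_sq]

/-- 1 - Laplacian / (4 pi^2) -/
def Lam (u : E3 × ℝ → ℝ) : E3 × ℝ → ℝ := fun z => u z + (-(1 / (4 * Real.pi ^ 2))) * Lp u z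

lemma Sm.Lam {u} (hu : Sm u) : Sm (Lam u) := hu.add (hu.Lp.const_mul _)

lemma Sm.F_Lam {u} (hu : Sm u) (ξ t) :
    F (QI.Lam u) ξ t = ((1 + ‖ξ‖ ^ 2 : ℝ) : ℂ) * F u ξ t := by
  unfold QI.Lam
  rw [F_add hu (hu.Lp.const_mul _), F_const_mul, hu.F_Lp]
  have : (Real.pi : ℂ) ≠ 0 := by exact_mod_cast Real.pi_ne_zero
  push_cast
  field_simp

lemma Sm.decay {u} (hu : Sm u) : ∃ C, 0 ≤ C ∧ ∀ ξ t, (1 + ‖ξ‖ ^ 2) ^ 3 * ‖F u ξ t‖ ≤ C := by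
  obtain ⟨C, hC, h⟩ := hu.Lam.Lam.Lam.F_bdd
  refine ⟨C, hC, fun ξ t => ?_⟩
  have := h ξ t
  rw [hu.Lam.Lam.F_Lam, hu.Lam.F_Lam, hu.F_Lam] at this
  simp only [norm_mul, Complex.norm_real, Real.norm_eq_abs] at this
  rw [abs_of_pos (by positivity)] at this
  calc _ = _ := by ring
    _ ≤ C := this

/-- integrable weight -/
def J (ξ : E3) : ℝ := ((1 + ‖ξ‖ ^ 2) ^ 2)⁻¹

lemma J_int : Integrable J := by
  have := integrable_rpow_neg_one_add_norm_sq (E := E3) (μ := volume) (r := 4) (by simp; norm_num)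
  refine this.congr (Filter.Eventually.of_forall fun ξ => ?_)
  simp only [J]
  rw [show (-4 / 2 : ℝ) = -((2 : ℕ) : ℝ) by norm_num, Real.rpow_neg (by positivity), Real.rpow_natCast]
lemma J_nonneg (ξ) : 0 ≤ J ξ := by unfold J; positivity
lemma J_cont : Continuous J := by
  unfold J
  refine Continuous.inv₀ (by fun_prop) fun x => by positivity

lemma Sm.decayJ {u} (hu : Sm u) : ∃ C, 0 ≤ C ∧ ∀ r : ℕ, r ≤ 2 → ∀ ξ t, ‖ξ‖ ^ r * ‖F u ξ t‖ ≤ C * J ξ := by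
  obtain ⟨C, hC, h⟩ := hu.decay
  refine ⟨C, hC, fun r hr ξ t => ?_⟩
  have h1 : ‖ξ‖ ^ r ≤ 1 + ‖ξ‖ ^ 2 := by
    interval_cases r
    · simp; 
    · nlinarith [sq_nonneg (‖ξ‖ - 1)]
    · simp
  unfold J
  rw [← div_eq_mul_inv, le_div_iff₀ (by positivity)]
  calc _ ≤ (1 + ‖ξ‖ ^ 2) * ‖F u ξ t‖ * (1 + ‖ξ‖ ^ 2) ^ 2 := by gcongr
    _ = (1 + ‖ξ‖ ^ 2) ^ 3 * ‖F u ξ t‖ := by ring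
    _ ≤ C := h ξ t

/-- weighted Wiener norms -/
def Nm (r : ℕ) (u : E3 × ℝ → ℝ) (t : ℝ) : ℝ := ∫ ξ : E3, ‖ξ‖ ^ r * ‖F u ξ t‖

lemma Nm_nonneg (r u t) : 0 ≤ Nm r u t := integral_nonneg fun ξ => by positivity

lemma Nm_congr {u w : E3 × ℝ → ℝ} {t} (h : ∀ x, u (x, t) = w (x, t)) (r) : Nm r u t = Nm r w t := by
  simp only [Nm, F_congr h]

lemma Sm.Ncont {u} (hu : Sm u) (r : ℕ) : Continuous fun z : E3 × ℝ => ‖z.1‖ ^ r * ‖F u z.1 z.2‖ := by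
  have := hu.F_cont
  fun_prop

lemma Sm.Nint {u} (hu : Sm u) {r : ℕ} (hr : r ≤ 2) (t) :
    Integrable fun ξ : E3 => ‖ξ‖ ^ r * ‖F u ξ t‖ := by
  obtain ⟨C, hC, h⟩ := hu.decayJ
  refine (J_int.const_mul C).mono' ?_ (Filter.Eventually.of_forall fun ξ => ?_)
  · exact ((hu.Ncont r).comp (by fun_prop : Continuous fun ξ : E3 => (ξ, t))).aestronglyMeasurable
  · rw [Real.norm_of_nonneg (by positivity)]; exact h r hr ξ t

lemma Sm.Nm_cont {u} (hu : Sm u) {r : ℕ} (hr : r ≤ 2) : Continuous (Nm r u) := by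
  obtain ⟨C, hC, h⟩ := hu.decayJ
  refine continuous_of_dominated (bound := fun ξ => C * J ξ) ?_ ?_ (J_int.const_mul C) ?_
  · exact fun t => (hu.Nint hr t).aestronglyMeasurable
  · exact fun t => Filter.Eventually.of_forall fun ξ => by
      rw [Real.norm_of_nonneg (by positivity)]; exact h r hr ξ t
  · refine Filter.Eventually.of_forall fun ξ => ?_
    have h1 : Continuous fun t : ℝ => ((ξ, t) : E3 × ℝ) := by fun_prop
    have h2 := (hu.Ncont r).comp h1
    exact h2

lemma Sm.Nm_bdd {u} (hu : Sm u) {r : ℕ} (hr : r ≤ 2) : ∃ C, ∀ t, Nm r u t ≤ C := by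
  obtain ⟨C, hC, h⟩ := hu.decayJ
  exact ⟨∫ ξ, C * J ξ, fun t => integral_mono (hu.Nint hr t) (J_int.const_mul C) fun ξ => h r hr ξ t⟩

lemma Nm_add {u w} (hu : Sm u) (hw : Sm w) {r : ℕ} (hr : r ≤ 2) (t) :
    Nm r (fun z => u z + w z) t ≤ Nm r u t + Nm r w t := by
  unfold Nm
  rw [← integral_add (hu.Nint hr t) (hw.Nint hr t)]
  refine integral_mono ((hu.add hw).Nint hr t) ((hu.Nint hr t).add (hw.Nint hr t)) fun ξ => ?_
  simp only [F_add hu hw, Pi.add_apply]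
  rw [← mul_add]
  gcongr
  exact norm_add_le _ _

lemma Nm_const_mul (u : E3 × ℝ → ℝ) (c : ℝ) (r t) :
    Nm r (fun z => c * u z) t = |c| * Nm r u t := by
  unfold Nm
  rw [← integral_const_mul]
  congr 1; funext ξ
  rw [F_const_mul, norm_mul, Complex.norm_real, Real.norm_eq_abs]; ring

lemma Nm_sum {ι : Type*} (s : Finset ι) {u : ι → E3 × ℝ → ℝ} (hu : ∀ i, Sm (u i)) {r : ℕ}
    (hr : r ≤ 2) (t) : Nm r (fun z => ∑ i ∈ s, u i z) t ≤ ∑ i ∈ s, Nm r (u i) t := by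
  classical
  induction s using Finset.induction_on with
  | empty => simp [Nm, F_zero]
  | insert a s ha ih =>
    simp only [Finset.sum_insert ha]
    exact (Nm_add (hu a) (Sm.sum s hu) hr t).trans (by gcongr)

lemma abs_coord_le (ξ : E3) (j) : |ξ j| ≤ ‖ξ‖ := by
  simpa using EuclideanSpace.norm_eq ξ ▸ (PiLp.norm_apply_le ξ j)

lemma Nm_Dx {u} (hu : Sm u) (j) {r : ℕ} (hr : r + 1 ≤ 2) (t) :
    Nm r (Dv (ex j) u) t ≤ 2 * Real.pi * Nm (r + 1) u t := by
  unfold Nm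
  rw [← integral_const_mul]
  refine integral_mono ((hu.Dv _).Nint (by lia) t) ((hu.Nint hr t).const_mul _) fun ξ => ?_
  simp only [hu.F_Dx, norm_mul, Complex.norm_real, Complex.norm_I, Real.norm_eq_abs,
    Complex.norm_ofNat, abs_of_pos Real.pi_pos, mul_one]
  have := abs_coord_le ξ j
  calc ‖ξ‖ ^ r * (2 * Real.pi * |ξ j| * ‖F u ξ t‖) ≤ ‖ξ‖ ^ r * (2 * Real.pi * ‖ξ‖ * ‖F u ξ t‖) := by
        have := Real.pi_pos; gcongr
    _ = _ := by ring

lemma Nm_interp {u} (hu : Sm u) (t) {δ : ℝ} (hδ : 0 < δ) :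
    Nm 1 u t ≤ δ⁻¹ * Nm 0 u t + δ * Nm 2 u t := by
  unfold Nm
  rw [← integral_const_mul, ← integral_const_mul, ← integral_add
    ((hu.Nint (by lia) t).const_mul _) ((hu.Nint (by lia) t).const_mul _)]
  refine integral_mono (hu.Nint (by lia) t) (((hu.Nint (by lia) t).const_mul _).add
    ((hu.Nint (by lia) t).const_mul _)) fun ξ => ?_
  have : ‖ξ‖ ^ 1 ≤ δ⁻¹ * ‖ξ‖ ^ 0 + δ * ‖ξ‖ ^ 2 := by
    have h1 : δ⁻¹ * ‖ξ‖ ^ 0 + δ * ‖ξ‖ ^ 2 - ‖ξ‖ ^ 1 = δ⁻¹ * ((δ * ‖ξ‖ - 1 / 2) ^ 2 + 3 / 4) := by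
      field_simp; ring
    have : 0 ≤ δ⁻¹ * ((δ * ‖ξ‖ - 1 / 2) ^ 2 + 3 / 4) := by positivity
    linarith
  calc _ ≤ (δ⁻¹ * ‖ξ‖ ^ 0 + δ * ‖ξ‖ ^ 2) * ‖F u ξ t‖ := by gcongr
    _ = _ := by ring

/-- slice as a Schwartz function -/
def Sm.sch {u} (hu : Sm u) (t : ℝ) : SchwartzMap E3 ℂ :=
  HasCompactSupport.toSchwartzMap (f := fun x : E3 => (u (x, t) : ℂ))
    ((hu.slice_supp t).comp_left (g := fun r : ℝ => (r : ℂ)) (by simp))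
    (Complex.ofRealCLM.contDiff.comp (hu.1.comp (by fun_prop)))

lemma Sm.sch_apply {u} (hu : Sm u) (t x) : hu.sch t x = (u (x, t) : ℂ) := rfl

lemma Sm.finv {u} (hu : Sm u) (t ξ) : (𝓕⁻ (hu.sch t)) ξ = F u (-ξ) t := by
  rw [SchwartzMap.fourierInv_coe, Real.fourierInv_eq_fourier_neg]
  rfl

lemma Nm0_eq {u} (hu : Sm u) (t) : Nm 0 u t = ∫ ξ, ‖(𝓕⁻ (hu.sch t)) ξ‖ := by
  simp only [hu.finv, Nm, pow_zero, one_mul]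
  rw [integral_neg_eq_self (fun ξ => ‖F u ξ t‖)]

lemma abs_le_Nm {u} (hu : Sm u) (x t) : |u (x, t)| ≤ Nm 0 u t := by
  have h : (𝓕 (𝓕⁻ (hu.sch t))) x = (u (x, t) : ℂ) := by
    rw [FourierTransform.fourier_fourierInv_eq]; rfl
  have : |u (x, t)| = ‖(𝓕 (𝓕⁻ (hu.sch t))) x‖ := by rw [h]; simp
  rw [this, Nm0_eq hu, SchwartzMap.fourier_coe, Real.fourier_eq]
  refine (norm_integral_le_integral_norm _).trans (le_of_eq ?_)
  simp [Circle.norm_smul]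

open scoped Convolution in
lemma Nm_mul {u w} (hu : Sm u) (hw : Sm w) (t) :
    Nm 0 (fun z => u z * w z) t ≤ Nm 0 u t * Nm 0 w t := by
  rw [Nm0_eq (hu.mul hw), Nm0_eq hu, Nm0_eq hw]
  set f := 𝓕⁻ (hu.sch t) with hf
  set g := 𝓕⁻ (hw.sch t) with hg
  have h1 : 𝓕⁻ ((hu.mul hw).sch t) = SchwartzMap.convolution (ContinuousLinearMap.mul ℂ ℂ) f g := by
    have h2 : SchwartzMap.pairing (ContinuousLinearMap.mul ℂ ℂ) (𝓕 f) (𝓕 g) = (hu.mul hw).sch t := by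
      rw [hf, hg, FourierTransform.fourier_fourierInv_eq, FourierTransform.fourier_fourierInv_eq]
      ext x
      simp [SchwartzMap.pairing_apply_apply, Sm.sch_apply]
    rw [← h2, ← SchwartzMap.fourier_convolution, FourierTransform.fourierInv_fourier_eq]
  rw [h1]
  have h3 := integral_convolution (μ := volume) (ν := volume) (ContinuousLinearMap.mul ℝ ℝ)
    f.integrable.norm g.integrable.norm
  simp only [ContinuousLinearMap.mul_apply'] at h3
  rw [← h3]
  refine integral_mono (SchwartzMap.integrable _).norm
    (f.integrable.norm.integrable_convolution _ g.integrable.norm) fun ξ => ?_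
  simp only [SchwartzMap.convolution_apply]
  unfold convolution
  refine (norm_integral_le_integral_norm _).trans (le_of_eq ?_)
  simp

end QI

namespace QI

lemma ode_est {c t μ : ℝ} (hct : c ≤ t) (hμ : 0 ≤ μ) {W W' : ℝ → ℂ} {g : ℝ → ℝ}
    (hW : Continuous W) (hg : Continuous g)
    (hd : ∀ s ∈ Set.Ioo c t, HasDerivAt W (W' s) s)
    (hb : ∀ s ∈ Set.Ioo c t, ‖W' s + μ * W s‖ ≤ g s) :
    ‖W t‖ + μ * (∫ s in c..t, ‖W s‖) ≤ ‖W c‖ + ∫ s in c..t, g s := by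
  have key : ∀ ε : ℝ, 0 < ε → ‖W t‖ + μ * (∫ s in c..t, ‖W s‖) ≤
      ‖W c‖ + (∫ s in c..t, g s) + ε * (1 + μ * (t - c)) := by
    intro ε hε
    set f : ℝ → ℝ := fun s => √(‖W s‖ ^ 2 + ε ^ 2) with hf
    have hpos : ∀ s, 0 < ‖W s‖ ^ 2 + ε ^ 2 := fun s => by positivity
    have hfc : Continuous f := by fun_prop
    have hfW : ∀ s, ‖W s‖ ≤ f s := fun s => by
      apply Real.le_sqrt_of_sq_le; nlinarith
    have hfW2 : ∀ s, f s ≤ ‖W s‖ + ε := fun s => by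
      apply Real.sqrt_le_iff.2
      refine ⟨by positivity, ?_⟩
      have := norm_nonneg (W s)
      nlinarith
    have hfp : ∀ s, 0 < f s := fun s => Real.sqrt_pos.2 (hpos s)
    have hder : ∀ s ∈ Set.Ioo c t, HasDerivAt f ((2 * ⟪W s, W' s⟫) / (2 * f s)) s := by
      intro s hs
      have h1 := ((hd s hs).norm_sq).add_const (ε ^ 2)
      exact h1.sqrt (hpos s).ne'
    have h := intervalIntegral.sub_le_integral_of_hasDeriv_right_of_le (g := f)
      (g' := fun s => (2 * ⟪W s, W' s⟫) / (2 * f s)) (φ := fun s => g s - μ * ‖W s‖ + μ * ε)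
      hct hfc.continuousOn (fun s hs => (hder s hs).hasDerivWithinAt)
      ((by fun_prop : Continuous fun s => g s - μ * ‖W s‖ + μ * ε).integrableOn_Icc) ?_
    · rw [intervalIntegral.integral_add, intervalIntegral.integral_sub,
        intervalIntegral.integral_const_mul] at h
      · simp at h
        have := hfW t
        have := hfW2 c
        nlinarith
      all_goals exact Continuous.intervalIntegrable (by fun_prop) _ _
    · intro s hs
      have h2 := hb s hs
      have h3 : ⟪W s, W' s⟫ = ⟪W s, W' s + μ * W s⟫ - μ * ‖W s‖ ^ 2 := by
        have : (μ : ℂ) * W s = μ • W s := by simp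
        rw [inner_add_right, this, real_inner_smul_right, real_inner_self_eq_norm_sq]; ring
      have h4 : ⟪W s, W' s + μ * W s⟫ ≤ ‖W s‖ * g s :=
        (real_inner_le_norm _ _).trans (by gcongr)
      have hg0 : 0 ≤ g s := (norm_nonneg _).trans h2
      beta_reduce
      rw [mul_div_mul_left _ _ (two_ne_zero), div_le_iff₀ (hfp s), h3]
      have h5 := hfW s
      have h6 := hfW2 s
      have h7 := hfp s
      have h8 : f s ^ 2 = ‖W s‖ ^ 2 + ε ^ 2 := Real.sq_sqrt (hpos s).le
      have h9 : (‖W s‖ - ε) * f s ≤ ‖W s‖ ^ 2 := by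
        by_cases hh : ‖W s‖ ≤ ε
        · nlinarith [sq_nonneg ‖W s‖]
        · nlinarith
      nlinarith [mul_le_mul_of_nonneg_left h5 hg0, mul_le_mul_of_nonneg_left h9 hμ]
  refine le_of_forall_pos_le_add fun η hη => ?_
  have hp : 0 < 1 + μ * (t - c) := by nlinarith [mul_nonneg hμ (sub_nonneg.2 hct)]
  have := key (η / (1 + μ * (t - c))) (by positivity)
  rwa [div_mul_cancel₀ _ hp.ne'] at this

lemma fub_int {w} (hw : Sm w) {r : ℕ} (hr : r ≤ 2) {φ : ℝ → ℝ} (hφ : Continuous φ) (c t : ℝ) :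
    Integrable (Function.uncurry fun (ξ : E3) (s : ℝ) => φ s * (‖ξ‖ ^ r * ‖F w ξ s‖))
      ((volume : Measure E3).prod (volume.restrict (Set.Ioc c t))) := by
  obtain ⟨C, hC, h⟩ := hw.decayJ
  have h1 : IntegrableOn (fun s => C * |φ s|) (Set.Ioc c t) :=
    (by fun_prop : Continuous fun s => C * |φ s|).integrableOn_Icc.mono_set Set.Ioc_subset_Icc_self
  refine (J_int.mul_prod h1).mono' ?_ (Filter.Eventually.of_forall fun z => ?_)
  · refine Continuous.aestronglyMeasurable ?_
    have := hw.Ncont r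
    exact (hφ.comp continuous_snd).mul this
  · simp only [Function.uncurry, norm_mul, norm_pow, Real.norm_eq_abs, abs_norm]
    have := mul_le_mul_of_nonneg_left (h r hr z.1 z.2) (abs_nonneg (φ z.2))
    linarith

lemma fub {w} (hw : Sm w) {r : ℕ} (hr : r ≤ 2) {φ : ℝ → ℝ} (hφ : Continuous φ) {c t : ℝ}
    (hct : c ≤ t) :
    ∫ ξ : E3, (∫ s in c..t, φ s * (‖ξ‖ ^ r * ‖F w ξ s‖)) = ∫ s in c..t, φ s * Nm r w s := by
  simp only [intervalIntegral.integral_of_le hct]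
  rw [integral_integral_swap (fub_int hw hr hφ c t)]
  congr 1; funext s
  rw [integral_const_mul]; rfl

lemma fub_int' {w} (hw : Sm w) {r : ℕ} (hr : r ≤ 2) {φ : ℝ → ℝ} (hφ : Continuous φ) {c t : ℝ}
    (hct : c ≤ t) :
    Integrable fun ξ : E3 => (∫ s in c..t, φ s * (‖ξ‖ ^ r * ‖F w ξ s‖)) := by
  simp only [intervalIntegral.integral_of_le hct]
  exact (fub_int hw hr hφ c t).integral_prod_left

lemma heat_est {c t ν : ℝ} (hct : c ≤ t) (hν : 0 ≤ ν) {w g : E3 × ℝ → ℝ} (hw : Sm w) (hg : Sm g)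
    (heq : ∀ x, ∀ s ∈ Set.Ioo c t, Dv et w (x, s) = ν * Lp w (x, s) + g (x, s))
    {φ φ' : ℝ → ℝ} (hφ : Continuous φ) (hφ' : Continuous φ') (hd : ∀ s, HasDerivAt φ (φ' s) s)
    (h0 : ∀ s, c ≤ s → 0 ≤ φ s) (h0' : ∀ s, c ≤ s → 0 ≤ φ' s) :
    φ t * Nm 0 w t + 4 * Real.pi ^ 2 * ν * (∫ s in c..t, φ s * Nm 2 w s) ≤
      φ c * Nm 0 w c + (∫ s in c..t, φ' s * Nm 0 w s) + ∫ s in c..t, φ s * Nm 0 g s := by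
  have pt : ∀ ξ : E3, φ t * (‖ξ‖ ^ 0 * ‖F w ξ t‖) + 4 * Real.pi ^ 2 * ν *
      (∫ s in c..t, φ s * (‖ξ‖ ^ 2 * ‖F w ξ s‖)) ≤ φ c * (‖ξ‖ ^ 0 * ‖F w ξ c‖) +
      (∫ s in c..t, φ' s * (‖ξ‖ ^ 0 * ‖F w ξ s‖)) + ∫ s in c..t, φ s * (‖ξ‖ ^ 0 * ‖F g ξ s‖) := by
    intro ξ
    have hFw : Continuous fun s => F w ξ s := by
      have h1 : Continuous fun t : ℝ => ((ξ, t) : E3 × ℝ) := by fun_prop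
      have h2 := hw.F_cont.comp h1
      exact h2
    have hFg : Continuous fun s => F g ξ s := by
      have h1 : Continuous fun t : ℝ => ((ξ, t) : E3 × ℝ) := by fun_prop
      have h2 := hg.F_cont.comp h1
      exact h2
    have := ode_est (μ := 4 * Real.pi ^ 2 * ν * ‖ξ‖ ^ 2) hct (by positivity)
      (W := fun s => (φ s : ℂ) * F w ξ s)
      (W' := fun s => (φ' s : ℂ) * F w ξ s + (φ s : ℂ) * F (Dv et w) ξ s)
      (g := fun s => φ' s * (‖ξ‖ ^ 0 * ‖F w ξ s‖) + φ s * (‖ξ‖ ^ 0 * ‖F g ξ s‖)) (by fun_prop)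
      (by fun_prop) (fun s hs => (hd s).ofReal_comp.mul (hw.F_hasDerivAt ξ s)) ?_
    · rw [intervalIntegral.integral_add (Continuous.intervalIntegrable (by fun_prop) _ _)
        (Continuous.intervalIntegrable (by fun_prop) _ _)] at this
      simp only [norm_mul, Complex.norm_real, Real.norm_eq_abs] at this
      rw [abs_of_nonneg (h0 t hct), abs_of_nonneg (h0 c le_rfl)] at this
      have h3 : ∫ s in c..t, |φ s| * ‖F w ξ s‖ = ∫ s in c..t, φ s * ‖F w ξ s‖ := by
        refine intervalIntegral.integral_congr fun s hs => ?_
        rw [Set.uIcc_of_le hct] at hs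
        simp only [abs_of_nonneg (h0 s hs.1)]
      have h4 : ∫ s in c..t, φ s * (‖ξ‖ ^ 2 * ‖F w ξ s‖) =
          ‖ξ‖ ^ 2 * ∫ s in c..t, φ s * ‖F w ξ s‖ := by
        rw [← intervalIntegral.integral_const_mul]
        congr 1; funext s; ring
      rw [h3] at this
      rw [h4]
      simp only [pow_zero, one_mul] at this ⊢
      linarith
    · intro s hs
      have h5 : F (Dv et w) ξ s = -((4 * Real.pi ^ 2 * ν * ‖ξ‖ ^ 2 : ℝ) : ℂ) * F w ξ s + F g ξ s := by
        rw [F_congr (w := fun z => ν * Lp w z + g z) (fun x => heq x s hs) ξ,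
          F_add (hw.Lp.const_mul ν) hg, F_const_mul, hw.F_Lp]
        push_cast; ring
      have h6 : (φ' s : ℂ) * F w ξ s + (φ s : ℂ) * F (Dv et w) ξ s +
          ((4 * Real.pi ^ 2 * ν * ‖ξ‖ ^ 2 : ℝ) : ℂ) * ((φ s : ℂ) * F w ξ s) =
          (φ' s : ℂ) * F w ξ s + (φ s : ℂ) * F g ξ s := by rw [h5]; ring
      rw [h6]
      refine (norm_add_le _ _).trans (le_of_eq ?_)
      simp [abs_of_nonneg (h0 s hs.1.le), abs_of_nonneg (h0' s hs.1.le)]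
  have I1 := (hw.Nint (r := 0) (by lia) t).const_mul (φ t)
  have I2 := (fub_int' hw (r := 2) le_rfl hφ hct).const_mul (4 * Real.pi ^ 2 * ν)
  have I3 := (hw.Nint (r := 0) (by lia) c).const_mul (φ c)
  have I4 := (fub_int' hw (r := 0) (by lia) hφ' hct)
  have I5 := (fub_int' hg (r := 0) (by lia) hφ hct)
  have := integral_mono (I1.add I2) ((I3.add I4).add I5) pt
  simp only [Pi.add_apply] at this
  rw [integral_add (by exact I1) (by exact I2), integral_add (by exact I3.add I4) (by exact I5),
    integral_add (by exact I3) (by exact I4),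
    integral_const_mul, integral_const_mul, integral_const_mul, fub hw le_rfl hφ hct,
    fub hw (by lia) hφ' hct, fub hg (by lia) hφ hct] at this
  exact this

end QI

namespace QI

lemma boot {S : ℝ → ℝ} {c e A : ℝ} (hS : Continuous S)
    (h : ∀ t ∈ Set.Icc c e, (∀ s ∈ Set.Ico c t, S s ≤ A) → S t < A) :
    ∀ t ∈ Set.Icc c e, S t < A := by
  by_contra hcon
  push Not at hcon
  obtain ⟨t1, ht1, h1⟩ := hcon
  set Z := Set.Icc c e ∩ S ⁻¹' Set.Ici A with hZ
  have hc : IsCompact Z := isCompact_Icc.inter_right (isClosed_Ici.preimage hS)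
  have hne : Z.Nonempty := ⟨t1, ht1, h1⟩
  have hm := hc.sInf_mem hne
  have hlt := h _ hm.1 (fun s hs => by
    by_contra hh
    have : s ∈ Z := ⟨⟨hs.1, hs.2.le.trans hm.1.2⟩, (not_le.1 hh).le⟩
    exact absurd (csInf_le hc.bddBelow this) (not_le.2 hs.2))
  exact absurd hm.2 (not_le.2 hlt)

lemma conv_le {f g : ℕ → ℝ} (hf : ∀ k, 0 ≤ f k) (hg : ∀ k, 0 ≤ g k) {ρ : ℝ} (hρ : 0 ≤ ρ) (n : ℕ) :
    ∑ k ∈ Finset.range n, ρ ^ k * ∑ p ∈ Finset.HasAntidiagonal.antidiagonal k, f p.1 * g p.2 ≤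
      (∑ k ∈ Finset.range n, ρ ^ k * f k) * ∑ k ∈ Finset.range n, ρ ^ k * g k := by
  have h1 : ∀ k ∈ Finset.range n, ρ ^ k * ∑ p ∈ Finset.HasAntidiagonal.antidiagonal k, f p.1 * g p.2 =
      ∑ j ∈ Finset.range (k + 1), (ρ ^ j * f j) * (ρ ^ (k - j) * g (k - j)) := by
    intro k _
    rw [Finset.Nat.sum_antidiagonal_eq_sum_range_succ_mk, Finset.mul_sum]
    refine Finset.sum_congr rfl fun j hj => ?_
    have : k = j + (k - j) := by have := Finset.mem_range.1 hj; lia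
    calc ρ ^ k * (f j * g (k - j)) = ρ ^ (j + (k - j)) * (f j * g (k - j)) := by rw [← this]
      _ = _ := by rw [pow_add]; ring
  rw [Finset.sum_congr rfl h1, Finset.sum_range_diag_flip n
    (fun a b => (ρ ^ a * f a) * (ρ ^ b * g b)), Finset.sum_mul_sum]
  refine Finset.sum_le_sum fun i _ => ?_
  refine Finset.sum_le_sum_of_subset_of_nonneg ?_ ?_
  · intro x hx
    simp only [Finset.mem_range] at *
    lia
  · intro k _ _
    have := hf i; have := hg k
    positivity

lemma hier {α β γ G : ℕ → ℝ → ℝ} {c e m P L Q M0 A δ ρ T : ℝ}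
    (cα : ∀ k, Continuous (α k)) (cβ : ∀ k, Continuous (β k)) (cG : ∀ k, Continuous (G k))
    (nα : ∀ k, ∀ s, c ≤ s → 0 ≤ α k s) (nβ : ∀ k, ∀ s, c ≤ s → 0 ≤ β k s)
    (nγ : ∀ k, ∀ s, c ≤ s → 0 ≤ γ k s) (nG : ∀ k, ∀ s, c ≤ s → 0 ≤ G k s)
    (hinter : ∀ k, ∀ s, c ≤ s → γ k s ≤ δ⁻¹ * α k s + δ * β k s)
    (h0 : ∀ t ∈ Set.Icc c e, α 0 t + m * (∫ s in c..t, β 0 s) ≤ α 0 c + ∫ s in c..t, G 0 s)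
    (hk : ∀ k, ∀ t ∈ Set.Icc c e, α (k + 1) t + m * (∫ s in c..t, β (k + 1) s) ≤
      ∫ s in c..t, (G (k + 1) s + m * β k s + G k s))
    (hG0 : ∀ s ∈ Set.Ioo c e, G 0 s ≤ P * (α 0 s * γ 0 s) + Q)
    (hGk : ∀ k, ∀ s ∈ Set.Ioo c e, G (k + 1) s ≤
      P * (∑ p ∈ Finset.HasAntidiagonal.antidiagonal (k + 1), α p.1 s * γ p.2 s) + L * β k s)
    (hm : 0 ≤ m) (hP : 0 ≤ P) (hL : 0 ≤ L) (hQ : 0 ≤ Q) (hα0 : α 0 c ≤ M0) (hM0 : 0 ≤ M0)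
    (hA : A = M0 + 1)
    (hδ : 0 < δ) (hρ : 0 ≤ ρ) (hρ1 : ρ ≤ 1)
    (hc1 : 4 * P * A * δ + ρ * (2 * L + m) ≤ m / 2)
    (hT : e - c ≤ T) (hc2 : T * (8 * P * A ^ 2 * δ⁻¹ + 2 * Q) ≤ 1 / 2) (n : ℕ) :
    ∀ t ∈ Set.Icc c e, ∑ k ∈ Finset.range (n + 1), ρ ^ k * α k t < 2 * A := by
  refine boot (by have := cα; fun_prop) ?_
  intro t ht hS
  set S : ℝ → ℝ := fun s => ∑ k ∈ Finset.range (n + 1), ρ ^ k * α k s with hSdef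
  set B : ℝ → ℝ := fun s => ∑ k ∈ Finset.range (n + 1), ρ ^ k * β k s with hBdef
  set H : ℝ → ℝ := fun s => ∑ k ∈ Finset.range (n + 1), ρ ^ k * G k s with hHdef
  have cB : Continuous B := by fun_prop
  have cH : Continuous H := by fun_prop
  have nS : ∀ s, c ≤ s → 0 ≤ S s := fun s hs => Finset.sum_nonneg fun k _ =>
    mul_nonneg (by positivity) (nα k s hs)
  have nB : ∀ s, c ≤ s → 0 ≤ B s := fun s hs => Finset.sum_nonneg fun k _ =>
    mul_nonneg (by positivity) (nβ k s hs)
  have nH : ∀ s, c ≤ s → 0 ≤ H s := fun s hs => Finset.sum_nonneg fun k _ =>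
    mul_nonneg (by positivity) (nG k s hs)
  have sh : ∀ f : ℕ → ℝ, (∀ k, 0 ≤ f k) → ∑ k ∈ Finset.range n, ρ ^ (k + 1) * f k ≤
      ρ * ∑ k ∈ Finset.range (n + 1), ρ ^ k * f k := by
    intro f hf
    rw [Finset.sum_range_succ, mul_add, Finset.mul_sum]
    have : 0 ≤ ρ * (ρ ^ n * f n) := by have := hf n; positivity
    have h2 : ∑ k ∈ Finset.range n, ρ ^ (k + 1) * f k = ∑ k ∈ Finset.range n, ρ * (ρ ^ k * f k) :=
      Finset.sum_congr rfl fun k _ => by ring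
    linarith
  -- step 1
  have st1 : S t + m * (∫ s in c..t, B s) ≤ M0 + ∫ s in c..t, (2 * H s + ρ * m * B s) := by
    have e1 : ∫ s in c..t, B s = ∑ k ∈ Finset.range (n + 1), ρ ^ k * ∫ s in c..t, β k s := by
      rw [hBdef, intervalIntegral.integral_finsetSum]
      · simp only [intervalIntegral.integral_const_mul]
      · exact fun k _ => Continuous.intervalIntegrable (by fun_prop) _ _
    have e2 : S t + m * (∫ s in c..t, B s) = (α 0 t + m * (∫ s in c..t, β 0 s)) +
        ∑ k ∈ Finset.range n, ρ ^ (k + 1) * (α (k + 1) t + m * (∫ s in c..t, β (k + 1) s)) := by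
      rw [e1, hSdef]
      beta_reduce
      rw [Finset.mul_sum, ← Finset.sum_add_distrib, Finset.sum_range_succ']
      rw [add_comm]
      congr 1
      · ring
      · exact Finset.sum_congr rfl fun k _ => by ring
    have e3 : (∫ s in c..t, G 0 s) + ∑ k ∈ Finset.range n, ρ ^ (k + 1) *
        (∫ s in c..t, (G (k + 1) s + m * β k s + G k s)) = ∫ s in c..t, (G 0 s +
        ∑ k ∈ Finset.range n, ρ ^ (k + 1) * (G (k + 1) s + m * β k s + G k s)) := by
      rw [intervalIntegral.integral_add, intervalIntegral.integral_finsetSum]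
      · simp only [intervalIntegral.integral_const_mul]
      · exact fun k _ => Continuous.intervalIntegrable (by fun_prop) _ _
      · exact Continuous.intervalIntegrable (by fun_prop) _ _
      · exact Continuous.intervalIntegrable (by fun_prop) _ _
    have e4 : ∫ s in c..t, (G 0 s + ∑ k ∈ Finset.range n, ρ ^ (k + 1) *
        (G (k + 1) s + m * β k s + G k s)) ≤ ∫ s in c..t, (2 * H s + ρ * m * B s) := by
      refine intervalIntegral.integral_mono_on ht.1
        (Continuous.intervalIntegrable (by fun_prop) _ _)
        (Continuous.intervalIntegrable (by fun_prop) _ _) fun s hs => ?_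
      have f1 : G 0 s + ∑ k ∈ Finset.range n, ρ ^ (k + 1) * (G (k + 1) s + m * β k s + G k s) =
          H s + m * (∑ k ∈ Finset.range n, ρ ^ (k + 1) * β k s) +
            ∑ k ∈ Finset.range n, ρ ^ (k + 1) * G k s := by
        rw [hHdef]
        beta_reduce
        rw [Finset.sum_range_succ', Finset.mul_sum]
        have : ∑ k ∈ Finset.range n, ρ ^ (k + 1) * (G (k + 1) s + m * β k s + G k s) =
            ∑ k ∈ Finset.range n, ρ ^ (k + 1) * G (k + 1) s +
            ∑ k ∈ Finset.range n, m * (ρ ^ (k + 1) * β k s) +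
            ∑ k ∈ Finset.range n, ρ ^ (k + 1) * G k s := by
          rw [← Finset.sum_add_distrib, ← Finset.sum_add_distrib]
          exact Finset.sum_congr rfl fun k _ => by ring
        rw [this]
        ring
      rw [f1]
      have f2 := sh (fun k => β k s) fun k => nβ k s hs.1
      have f3 := sh (fun k => G k s) fun k => nG k s hs.1
      have f4 : ρ * H s ≤ 1 * H s := mul_le_mul_of_nonneg_right hρ1 (nH s hs.1)
      have f5 := mul_le_mul_of_nonneg_left f2 hm
      have f6 : ρ * m * B s = m * (ρ * ∑ k ∈ Finset.range (n + 1), ρ ^ k * β k s) := by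
        rw [hBdef]; ring
      have f7 : ρ * H s = ρ * ∑ k ∈ Finset.range (n + 1), ρ ^ k * G k s := rfl
      linarith
    have g1 := h0 t ht
    have g2 := Finset.sum_le_sum fun k (_ : k ∈ Finset.range n) =>
      mul_le_mul_of_nonneg_left (hk k t ht) (by positivity : 0 ≤ ρ ^ (k + 1))
    linarith
  -- step 2
  have st2 : ∫ s in c..t, (2 * H s + ρ * m * B s) ≤
      ∫ s in c..t, ((8 * P * A ^ 2 * δ⁻¹ + 2 * Q) + m / 2 * B s) := by
    refine intervalIntegral.integral_mono_on_of_le_Ioo ht.1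
      (Continuous.intervalIntegrable (by fun_prop) _ _)
      (Continuous.intervalIntegrable (by fun_prop) _ _) fun s hs => ?_
    have hse : s ∈ Set.Ioo c e := ⟨hs.1, hs.2.trans_le ht.2⟩
    set Γ := ∑ k ∈ Finset.range (n + 1), ρ ^ k * γ k s with hΓ
    have nΓ : 0 ≤ Γ := Finset.sum_nonneg fun k _ => mul_nonneg (by positivity) (nγ k s hs.1.le)
    have k1 : Γ ≤ δ⁻¹ * S s + δ * B s := by
      rw [hΓ, hSdef, hBdef]
      beta_reduce
      rw [Finset.mul_sum, Finset.mul_sum, ← Finset.sum_add_distrib]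
      refine Finset.sum_le_sum fun k _ => ?_
      have := mul_le_mul_of_nonneg_left (hinter k s hs.1.le) (by positivity : 0 ≤ ρ ^ k)
      linarith
    have k2 : H s ≤ P * (S s * Γ) + Q + L * (ρ * B s) := by
      have c1 := conv_le (f := fun k => α k s) (g := fun k => γ k s) (fun k => nα k s hs.1.le)
        (fun k => nγ k s hs.1.le) hρ (n + 1)
      have c2 := mul_le_mul_of_nonneg_left c1 hP
      have c3 : H s ≤ P * (∑ k ∈ Finset.range (n + 1), ρ ^ k *
          ∑ p ∈ Finset.HasAntidiagonal.antidiagonal k, α p.1 s * γ p.2 s) + Q +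
          L * ∑ k ∈ Finset.range n, ρ ^ (k + 1) * β k s := by
        rw [hHdef]
        beta_reduce
        rw [Finset.sum_range_succ', Finset.sum_range_succ']
        have d1 := Finset.sum_le_sum fun k (_ : k ∈ Finset.range n) =>
          mul_le_mul_of_nonneg_left (hGk k s hse) (by positivity : 0 ≤ ρ ^ (k + 1))
        have d2 : ∑ k ∈ Finset.range n, ρ ^ (k + 1) * (P * (∑ p ∈
            Finset.HasAntidiagonal.antidiagonal (k + 1), α p.1 s * γ p.2 s) + L * β k s) =
            P * (∑ k ∈ Finset.range n, ρ ^ (k + 1) *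
              ∑ p ∈ Finset.HasAntidiagonal.antidiagonal (k + 1), α p.1 s * γ p.2 s) +
            L * ∑ k ∈ Finset.range n, ρ ^ (k + 1) * β k s := by
          rw [Finset.mul_sum, Finset.mul_sum, ← Finset.sum_add_distrib]
          exact Finset.sum_congr rfl fun k _ => by ring
        rw [d2] at d1
        have d3 := hG0 s hse
        simp
        linarith
      have c4 := mul_le_mul_of_nonneg_left (sh (fun k => β k s) fun k => nβ k s hs.1.le) hL
      exact c3.trans (by linarith)
    have k3 : S s ≤ 2 * A := hS s ⟨hs.1.le, hs.2⟩
    have nSs := nS s hs.1.le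
    have nBs := nB s hs.1.le
    have k4 : S s * Γ ≤ 2 * A * (δ⁻¹ * (2 * A) + δ * B s) := by
      refine mul_le_mul k3 (k1.trans ?_) nΓ (nSs.trans k3)
      gcongr
    have k5 := mul_le_mul_of_nonneg_left k4 hP
    have k6 := mul_le_mul_of_nonneg_right hc1 nBs
    linarith
  have st3 : ∫ s in c..t, ((8 * P * A ^ 2 * δ⁻¹ + 2 * Q) + m / 2 * B s) =
      (t - c) * (8 * P * A ^ 2 * δ⁻¹ + 2 * Q) + m / 2 * ∫ s in c..t, B s := by
    rw [intervalIntegral.integral_add, intervalIntegral.integral_const_mul]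
    · simp
      ring
    · exact Continuous.intervalIntegrable (by fun_prop) _ _
    · exact Continuous.intervalIntegrable (by fun_prop) _ _
  have iB : 0 ≤ ∫ s in c..t, B s :=
    intervalIntegral.integral_nonneg ht.1 fun s hs => nB s hs.1
  have st4 : (t - c) * (8 * P * A ^ 2 * δ⁻¹ + 2 * Q) ≤ 1 / 2 := by
    refine le_trans (mul_le_mul_of_nonneg_right ?_ (by positivity)) hc2
    linarith [ht.2]
  have : 0 ≤ m / 2 * ∫ s in c..t, B s := by positivity
  show S t < 2 * A
  linarith

end QI

namespace QI

/-- Functions agreeing on a time slab have the same derivatives there. -/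
lemma Dv_congr {f h : E3 × ℝ → ℝ} {c d : ℝ}
    (H : ∀ x, ∀ s ∈ Set.Ioo c d, f (x, s) = h (x, s)) (e) :
    ∀ x, ∀ s ∈ Set.Ioo c d, Dv e f (x, s) = Dv e h (x, s) := by
  intro x s hs
  unfold Dv
  have : f =ᶠ[nhds (x, s)] h := by
    have ho : IsOpen (Prod.snd ⁻¹' Set.Ioo c d : Set (E3 × ℝ)) := isOpen_Ioo.preimage continuous_snd
    filter_upwards [ho.mem_nhds (show (x, s) ∈ Prod.snd ⁻¹' Set.Ioo c d from hs)] with z hz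
    exact H z.1 z.2 hz
  rw [this.fderiv_eq]

lemma Dt_congr {f h : E3 × ℝ → ℝ} {c d : ℝ}
    (H : ∀ x, ∀ s ∈ Set.Ioo c d, f (x, s) = h (x, s)) (k) :
    ∀ x, ∀ s ∈ Set.Ioo c d, Dt k f (x, s) = Dt k h (x, s) := by
  induction k with
  | zero => exact H
  | succ k ih => rw [Dt_succ, Dt_succ]; exact Dv_congr ih _

lemma Dt_Lp {u} (hu : Sm u) (k) : Dt k (Lp u) = Lp (Dt k u) := by
  unfold Lp
  rw [Dt_sum _ (fun j => (hu.Dv _).Dv _)]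
  funext z
  refine Finset.sum_congr rfl fun j _ => ?_
  rw [Dt_Dv (hu.Dv _).1, Dt_Dv hu.1]

/-- nonlinearity -/
def NL (u : Fin 3 → E3 × ℝ → ℝ) (i : Fin 3) : E3 × ℝ → ℝ := fun z =>
  ∑ j, (u j z * Dv (ex j) (u i) z + (1 / 2) * (u i z * Dv (ex j) (u j) z))

/-- right hand side -/
def g0 (u : Fin 3 → E3 × ℝ → ℝ) (q : E3 × ℝ → ℝ) (i : Fin 3) : E3 × ℝ → ℝ := fun z =>
  (-1) * (NL u i z + Dv (ex i) q z)

/-- smooth compactly supported fields solving the system on a time slab -/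
structure Sol (ν K c d : ℝ) (u : Fin 3 → E3 × ℝ → ℝ) (q : E3 × ℝ → ℝ) : Prop where
  hu : ∀ i, Sm (u i)
  hq : Sm q
  mom : ∀ i x, ∀ s ∈ Set.Ioo c d, Dv et (u i) (x, s) = ν * Lp (u i) (x, s) + g0 u q i (x, s)
  mass : ∀ x, ∀ s ∈ Set.Ioo c d, Dv et q (x, s) = (-K) * ∑ j, Dv (ex j) (u j) (x, s)

lemma Sm.NL {u : Fin 3 → E3 × ℝ → ℝ} (hu : ∀ i, Sm (u i)) (i) : Sm (NL u i) :=
  Sm.sum _ fun j => ((hu j).mul ((hu i).Dv _)).add (((hu i).mul ((hu j).Dv _)).const_mul _)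
lemma Sm.g0 {u : Fin 3 → E3 × ℝ → ℝ} (hu : ∀ i, Sm (u i)) {q} (hq : Sm q) (i) : Sm (g0 u q i) :=
  ((Sm.NL hu i).add (hq.Dv _)).const_mul _

lemma Sol.momk {ν K c d u q} (h : Sol ν K c d u q) (k i) : ∀ x, ∀ s ∈ Set.Ioo c d,
    Dv et (Dt k (u i)) (x, s) = ν * Lp (Dt k (u i)) (x, s) + Dt k (g0 u q i) (x, s) := by
  intro x s hs
  have h1 := Dt_congr (h := fun z => ν * Lp (u i) z + g0 u q i z) (h.mom i) k x s hs
  rw [Dt_Dv (h.hu i).1, Dt_add ((h.hu i).Lp.const_mul ν) (Sm.g0 h.hu h.hq i),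
    Dt_const_mul (h.hu i).Lp, Dt_Lp (h.hu i)] at h1
  exact h1

lemma Sol.massk {ν K c d u q} (h : Sol ν K c d u q) (k) : ∀ x, ∀ s ∈ Set.Ioo c d,
    Dt (k + 1) q (x, s) = (-K) * ∑ j, Dv (ex j) (Dt k (u j)) (x, s) := by
  intro x s hs
  have h1 := Dt_congr (h := fun z => (-K) * ∑ j, Dv (ex j) (u j) z) h.mass k x s hs
  rw [Dt_Dv h.hq.1, Dt_const_mul (Sm.sum _ fun j => (h.hu j).Dv _), Dt_sum _ fun j => (h.hu j).Dv _,
    ← Dt_succ] at h1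
  rw [h1]
  simp only [Dt_Dv (h.hu _).1]

/-- normalized weight -/
def ph (c : ℝ) (k : ℕ) (t : ℝ) : ℝ := (t - c) ^ k / k.factorial

lemma ph_cont (c k) : Continuous (ph c k) := by unfold ph; fun_prop
lemma ph_nonneg {c : ℝ} (k) {s : ℝ} (h : c ≤ s) : 0 ≤ ph c k s := by
  unfold ph; have : 0 ≤ s - c := by linarith
  positivity
lemma ph_deriv (c k s) : HasDerivAt (ph c (k + 1)) (ph c k s) s := by
  have h := (((hasDerivAt_id s).sub_const c).pow (k + 1)).div_const ((k + 1).factorial : ℝ)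
  have e : ((k + 1 : ℕ) : ℝ) * (id s - c) ^ (k + 1 - 1) * 1 / ((k + 1).factorial : ℝ) = ph c k s := by
    rw [Nat.factorial_succ, ph]
    have : (k.factorial : ℝ) ≠ 0 := by positivity
    have : (k + 1 : ℝ) ≠ 0 := by positivity
    push_cast
    simp only [id, Nat.add_sub_cancel]
    field_simp
  rw [e] at h
  exact h
lemma ph_choose (c t : ℝ) {k : ℕ} {p : ℕ × ℕ} (hp : p ∈ Finset.HasAntidiagonal.antidiagonal k) :
    ph c k t * (k.choose p.1 : ℝ) = ph c p.1 t * ph c p.2 t := by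
  have := Finset.HasAntidiagonal.mem_antidiagonal.1 hp
  subst this
  unfold ph
  rw [Nat.cast_add_choose]
  have : ((p.1 + p.2).factorial : ℝ) ≠ 0 := by positivity
  have : (p.1.factorial : ℝ) ≠ 0 := by positivity
  have : (p.2.factorial : ℝ) ≠ 0 := by positivity
  field_simp
  ring

/-- normalized norms of time derivatives -/
def M (c : ℝ) (r k : ℕ) (w : E3 × ℝ → ℝ) (t : ℝ) : ℝ := ph c k t * Nm r (Dt k w) t

lemma M_nonneg {c : ℝ} (r k w) {s : ℝ} (h : c ≤ s) : 0 ≤ M c r k w s :=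
  mul_nonneg (ph_nonneg k h) (Nm_nonneg _ _ _)
lemma M_cont (c : ℝ) {r : ℕ} (hr : r ≤ 2) (k) {w} (hw : Sm w) : Continuous (M c r k w) :=
  (ph_cont c k).mul ((hw.Dt k).Nm_cont hr)

lemma M_mul {c t : ℝ} (hct : c ≤ t) {a b} (ha : Sm a) (hb : Sm b) (k) :
    M c 0 k (fun z => a z * b z) t ≤
      ∑ p ∈ Finset.HasAntidiagonal.antidiagonal k, M c 0 p.1 a t * M c 0 p.2 b t := by
  unfold M
  rw [Dt_mul ha hb]
  have h1 : ∀ p : ℕ × ℕ, Sm fun z => (k.choose p.1 : ℝ) * (Dt p.1 a z * Dt p.2 b z) := fun p =>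
    ((ha.Dt _).mul (hb.Dt _)).const_mul _
  have h2 := mul_le_mul_of_nonneg_left (Nm_sum (Finset.HasAntidiagonal.antidiagonal k) h1
    (r := 0) (by lia) t) (ph_nonneg k hct)
  refine h2.trans ?_
  rw [Finset.mul_sum]
  refine Finset.sum_le_sum fun p hp => ?_
  rw [Nm_const_mul, abs_of_nonneg (by positivity), ← mul_assoc, ph_choose c t hp]
  have := Nm_mul (ha.Dt p.1) (hb.Dt p.2) t
  have h3 := mul_nonneg (ph_nonneg p.1 hct) (ph_nonneg p.2 hct)
  calc _ ≤ ph c p.1 t * ph c p.2 t * (Nm 0 (Dt p.1 a) t * Nm 0 (Dt p.2 b) t) := by gcongr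
    _ = _ := by ring

lemma M_Dx {c t : ℝ} (hct : c ≤ t) {a} (ha : Sm a) (j) {r : ℕ} (hr : r + 1 ≤ 2) (k) :
    M c r k (Dv (ex j) a) t ≤ 2 * Real.pi * M c (r + 1) k a t := by
  unfold M
  rw [Dt_Dv ha.1]
  have := mul_le_mul_of_nonneg_left (Nm_Dx (ha.Dt k) j hr t) (ph_nonneg k hct)
  linarith

lemma M_add {c t : ℝ} (hct : c ≤ t) {a b} (ha : Sm a) (hb : Sm b) {r : ℕ} (hr : r ≤ 2) (k) :
    M c r k (fun z => a z + b z) t ≤ M c r k a t + M c r k b t := by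
  unfold M
  rw [Dt_add ha hb, ← mul_add]
  exact mul_le_mul_of_nonneg_left (Nm_add (ha.Dt k) (hb.Dt k) hr t) (ph_nonneg k hct)
lemma M_sum {ι : Type*} (s : Finset ι) {c t : ℝ} (hct : c ≤ t) {a : ι → E3 × ℝ → ℝ}
    (ha : ∀ i, Sm (a i)) {r : ℕ} (hr : r ≤ 2) (k) :
    M c r k (fun z => ∑ i ∈ s, a i z) t ≤ ∑ i ∈ s, M c r k (a i) t := by
  unfold M
  rw [Dt_sum s ha, ← Finset.mul_sum]
  exact mul_le_mul_of_nonneg_left (Nm_sum s (fun i => (ha i).Dt k) hr t) (ph_nonneg k hct)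
lemma M_const_mul (b : ℝ) {c t : ℝ} {a} (ha : Sm a) (r k) :
    M c r k (fun z => b * a z) t = |b| * M c r k a t := by
  unfold M
  rw [Dt_const_mul ha, Nm_const_mul]; ring

/-- sum over components -/
def MS (c : ℝ) (r k : ℕ) (u : Fin 3 → E3 × ℝ → ℝ) (t : ℝ) : ℝ := ∑ i, M c r k (u i) t

lemma MS_nonneg {c : ℝ} (r k u) {s : ℝ} (h : c ≤ s) : 0 ≤ MS c r k u s :=
  Finset.sum_nonneg fun _ _ => M_nonneg _ _ _ h
lemma MS_cont (c : ℝ) {r : ℕ} (hr : r ≤ 2) (k) {u : Fin 3 → E3 × ℝ → ℝ} (hu : ∀ i, Sm (u i)) :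
    Continuous (MS c r k u) := by
  unfold MS
  exact continuous_finsetSum _ fun i _ => M_cont c hr k (hu i)

lemma M_NL {c t : ℝ} (hct : c ≤ t) {u : Fin 3 → E3 × ℝ → ℝ} (hu : ∀ i, Sm (u i)) (k) :
    ∑ i, M c 0 k (NL u i) t ≤ 3 * Real.pi *
      ∑ p ∈ Finset.HasAntidiagonal.antidiagonal k, MS c 0 p.1 u t * MS c 1 p.2 u t := by
  have hπ := Real.pi_pos
  have key : ∀ a b : Fin 3, ∀ j, M c 0 k (fun z => u a z * Dv (ex j) (u b) z) t ≤
      2 * Real.pi * ∑ p ∈ Finset.HasAntidiagonal.antidiagonal k,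
        M c 0 p.1 (u a) t * M c 1 p.2 (u b) t := by
    intro a b j
    refine (M_mul hct (hu a) ((hu b).Dv _) k).trans ?_
    rw [Finset.mul_sum]
    refine Finset.sum_le_sum fun p _ => ?_
    have h1 := M_Dx hct (hu b) j (r := 0) (by lia) p.2
    have h2 := mul_le_mul_of_nonneg_left h1 (M_nonneg 0 p.1 (u a) hct)
    simp only [zero_add] at h2
    linarith
  have h1 : ∀ i, M c 0 k (NL u i) t ≤ ∑ j, (2 * Real.pi *
      (∑ p ∈ Finset.HasAntidiagonal.antidiagonal k, M c 0 p.1 (u j) t * M c 1 p.2 (u i) t) +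
      Real.pi * (∑ p ∈ Finset.HasAntidiagonal.antidiagonal k,
        M c 0 p.1 (u i) t * M c 1 p.2 (u j) t)) := by
    intro i
    unfold NL
    refine (M_sum _ hct (fun j => ((hu j).mul ((hu i).Dv _)).add
      (((hu i).mul ((hu j).Dv _)).const_mul _)) (by lia) k).trans ?_
    refine Finset.sum_le_sum fun j _ => ?_
    refine (M_add hct ((hu j).mul ((hu i).Dv _))
      (((hu i).mul ((hu j).Dv _)).const_mul _) (by lia) k).trans ?_
    rw [M_const_mul (1 / 2) ((hu i).mul ((hu j).Dv _)), abs_of_pos (by norm_num)]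
    have := key j i j
    have := key i j j
    linarith
  refine (Finset.sum_le_sum fun i _ => h1 i).trans (le_of_eq ?_)
  unfold MS
  simp only [Finset.sum_add_distrib, ← Finset.mul_sum]
  have e1 : ∑ i : Fin 3, ∑ j : Fin 3, ∑ p ∈ Finset.HasAntidiagonal.antidiagonal k,
      M c 0 p.1 (u i) t * M c 1 p.2 (u j) t = ∑ p ∈ Finset.HasAntidiagonal.antidiagonal k,
      (∑ i, M c 0 p.1 (u i) t) * ∑ i, M c 1 p.2 (u i) t := by
    have : ∀ i : Fin 3, ∑ j : Fin 3, ∑ p ∈ Finset.HasAntidiagonal.antidiagonal k,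
      M c 0 p.1 (u i) t * M c 1 p.2 (u j) t = ∑ p ∈ Finset.HasAntidiagonal.antidiagonal k,
       ∑ j : Fin 3, M c 0 p.1 (u i) t * M c 1 p.2 (u j) t := fun i => Finset.sum_comm
    simp only [this]
    rw [Finset.sum_comm]
    refine Finset.sum_congr rfl fun p _ => ?_
    rw [Finset.sum_mul_sum]
  have e2 : ∑ i : Fin 3, ∑ j : Fin 3, ∑ p ∈ Finset.HasAntidiagonal.antidiagonal k,
      M c 0 p.1 (u j) t * M c 1 p.2 (u i) t = ∑ p ∈ Finset.HasAntidiagonal.antidiagonal k,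
      (∑ i, M c 0 p.1 (u i) t) * ∑ i, M c 1 p.2 (u i) t := by
    rw [Finset.sum_comm, e1]
  rw [e1, e2]
  ring

end QI

namespace QI

lemma Nm_Lp {w} (hw : Sm w) (t) : Nm 0 (Lp w) t = 4 * Real.pi ^ 2 * Nm 2 w t := by
  unfold Nm
  rw [← integral_const_mul]
  congr 1; funext ξ
  rw [hw.F_Lp, norm_mul, norm_neg, Complex.norm_real, Real.norm_of_nonneg (by positivity)]
  ring

lemma ph_le {c s : ℝ} (k) (h : c ≤ s) (h1 : s - c ≤ 1) : ph c (k + 1) s ≤ ph c k s := by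
  unfold ph
  have h0 : 0 ≤ s - c := by linarith
  apply div_le_div₀ (by positivity) _ (by positivity)
  · exact_mod_cast Nat.factorial_le (Nat.le_succ k)
  · exact pow_le_pow_of_le_one h0 h1 (Nat.le_succ k)

/-- source terms -/
def GS (c : ℝ) (k : ℕ) (u : Fin 3 → E3 × ℝ → ℝ) (q : E3 × ℝ → ℝ) (t : ℝ) : ℝ := ∑ i, M c 0 k (g0 u q i) t

lemma GS_nonneg {c : ℝ} (k u q) {s : ℝ} (h : c ≤ s) : 0 ≤ GS c k u q s :=
  Finset.sum_nonneg fun _ _ => M_nonneg _ _ _ h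
lemma GS_cont (c : ℝ) (k) {u : Fin 3 → E3 × ℝ → ℝ} {q} (hu : ∀ i, Sm (u i)) (hq : Sm q) :
    Continuous (GS c k u q) := by
  unfold GS
  exact continuous_finsetSum _ fun i _ => M_cont c (by lia) k (Sm.g0 hu hq i)

lemma GS_le {c t : ℝ} (hct : c ≤ t) {u : Fin 3 → E3 × ℝ → ℝ} {q} (hu : ∀ i, Sm (u i)) (hq : Sm q) (k) :
    GS c k u q t ≤ 3 * Real.pi * (∑ p ∈ Finset.HasAntidiagonal.antidiagonal k,
      MS c 0 p.1 u t * MS c 1 p.2 u t) + 6 * Real.pi * M c 1 k q t := by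
  have h1 := M_NL hct hu k
  have h2 : GS c k u q t ≤ ∑ i, (M c 0 k (NL u i) t + 2 * Real.pi * M c 1 k q t) := by
    refine Finset.sum_le_sum fun i _ => ?_
    unfold g0
    rw [M_const_mul (-1) ((Sm.NL hu i).add (hq.Dv _))]
    have := M_add hct (Sm.NL hu i) (hq.Dv (ex i)) (r := 0) (by lia) k
    have := M_Dx hct hq i (r := 0) (by lia) k
    simp at *
    linarith
  rw [Finset.sum_add_distrib] at h2
  simp at h2
  linarith

section
variable {ν K c0 d : ℝ} {u : Fin 3 → E3 × ℝ → ℝ} {q : E3 × ℝ → ℝ}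

lemma Sol.Nm_step (h : Sol ν K c0 d u q) (hν : 0 ≤ ν) (k i) {s} (hs : s ∈ Set.Ioo c0 d) :
    Nm 0 (Dt (k + 1) (u i)) s ≤ 4 * Real.pi ^ 2 * ν * Nm 2 (Dt k (u i)) s + Nm 0 (Dt k (g0 u q i)) s := by
  have hL := ((h.hu i).Dt k).Lp
  rw [Dt_succ, Nm_congr (w := fun z => ν * Lp (Dt k (u i)) z + Dt k (g0 u q i) z) (fun x => h.momk k i x s hs)]
  refine (Nm_add (hL.const_mul ν) ((Sm.g0 h.hu h.hq i).Dt k) (by lia) s).trans ?_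
  rw [Nm_const_mul, Nm_Lp ((h.hu i).Dt k), abs_of_nonneg hν]
  linarith

lemma Sol.Mq (h : Sol ν K c0 d u q) (hK : 0 ≤ K) (k) {c s} (hcs : c ≤ s) (h1 : s - c ≤ 1)
    (hs : s ∈ Set.Ioo c0 d) :
    M c 1 (k + 1) q s ≤ 2 * Real.pi * K * MS c 2 k u s := by
  unfold M MS
  rw [Nm_congr (w := fun z => (-K) * ∑ j, Dv (ex j) (Dt k (u j)) z) (fun x => h.massk k x s hs),
    Nm_const_mul, abs_neg, abs_of_nonneg hK]
  have h2 := Nm_sum Finset.univ (fun j => ((h.hu j).Dt k).Dv (ex j)) (r := 1) (by lia) s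
  have h3 : ∑ j, Nm 1 (Dv (ex j) (Dt k (u j))) s ≤ ∑ j, 2 * Real.pi * Nm 2 (Dt k (u j)) s :=
    Finset.sum_le_sum fun j _ => Nm_Dx ((h.hu j).Dt k) j (by lia) s
  have h4 : 0 ≤ ∑ j, 2 * Real.pi * Nm 2 (Dt k (u j)) s := Finset.sum_nonneg fun j _ => by
    have := Nm_nonneg 2 (Dt k (u j)) s; have := Real.pi_pos; positivity
  have h5 := ph_le k hcs h1
  have h6 := ph_nonneg (k + 1) hcs
  calc _ ≤ ph c (k + 1) s * (K * ∑ j, 2 * Real.pi * Nm 2 (Dt k (u j)) s) := by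
        have := h2.trans h3
        gcongr
    _ ≤ ph c k s * (K * ∑ j, 2 * Real.pi * Nm 2 (Dt k (u j)) s) := by gcongr
    _ = _ := by
      simp only [M, ← Finset.mul_sum]; ring

lemma Sol.est0 (h : Sol ν K c0 d u q) (hν : 0 ≤ ν) {c t} (hc : c0 ≤ c) (hct : c ≤ t) (ht : t ≤ d) :
    MS c 0 0 u t + 4 * Real.pi ^ 2 * ν * (∫ s in c..t, MS c 2 0 u s) ≤
      MS c 0 0 u c + ∫ s in c..t, GS c 0 u q s := by
  have key : ∀ i, M c 0 0 (u i) t + 4 * Real.pi ^ 2 * ν * (∫ s in c..t, M c 2 0 (u i) s) ≤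
      M c 0 0 (u i) c + ∫ s in c..t, M c 0 0 (g0 u q i) s := by
    intro i
    have := heat_est hct hν ((h.hu i).Dt 0) ((Sm.g0 h.hu h.hq i).Dt 0)
      (fun x s hs => h.momk 0 i x s ⟨hc.trans_lt hs.1, hs.2.trans_le ht⟩)
      (ph_cont c 0) (φ' := fun _ => 0) continuous_const
      (fun s => by
        have : ph c 0 = fun _ => 1 := by funext s; simp [ph]
        rw [this]; exact hasDerivAt_const _ _)
      (fun s hs => ph_nonneg 0 hs) (fun s hs => le_rfl)
    simpa [M] using this
  unfold MS GS
  rw [intervalIntegral.integral_finsetSum, intervalIntegral.integral_finsetSum, Finset.mul_sum,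
    ← Finset.sum_add_distrib, ← Finset.sum_add_distrib]
  · exact Finset.sum_le_sum fun i _ => key i
  · exact fun i _ => (M_cont c (by lia) 0 (Sm.g0 h.hu h.hq i)).intervalIntegrable _ _
  · exact fun i _ => (M_cont c (by lia) 0 (h.hu i)).intervalIntegrable _ _

lemma Sol.estk (h : Sol ν K c0 d u q) (hν : 0 ≤ ν) (k) {c t} (hc : c0 ≤ c) (hct : c ≤ t) (ht : t ≤ d) :
    MS c 0 (k + 1) u t + 4 * Real.pi ^ 2 * ν * (∫ s in c..t, MS c 2 (k + 1) u s) ≤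
      ∫ s in c..t, (GS c (k + 1) u q s + 4 * Real.pi ^ 2 * ν * MS c 2 k u s + GS c k u q s) := by
  have cg := fun k i => (M_cont c (r := 0) (by lia) k (Sm.g0 h.hu h.hq i))
  have c2 := fun k i => (M_cont c (r := 2) (by lia) k (h.hu i))
  have key : ∀ i, M c 0 (k + 1) (u i) t + 4 * Real.pi ^ 2 * ν * (∫ s in c..t, M c 2 (k + 1) (u i) s) ≤
      ∫ s in c..t, (M c 0 (k + 1) (g0 u q i) s + 4 * Real.pi ^ 2 * ν * M c 2 k (u i) s +
        M c 0 k (g0 u q i) s) := by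
    intro i
    have h1 := heat_est hct hν ((h.hu i).Dt (k + 1)) ((Sm.g0 h.hu h.hq i).Dt (k + 1))
      (fun x s hs => h.momk (k + 1) i x s ⟨hc.trans_lt hs.1, hs.2.trans_le ht⟩)
      (ph_cont c (k + 1)) (ph_cont c k) (ph_deriv c k)
      (fun s hs => ph_nonneg (k + 1) hs) (fun s hs => ph_nonneg k hs)
    have h0 : ph c (k + 1) c = 0 := by simp [ph]
    have h2 : ∫ s in c..t, ph c k s * Nm 0 (Dt (k + 1) (u i)) s ≤
        ∫ s in c..t, (4 * Real.pi ^ 2 * ν * M c 2 k (u i) s + M c 0 k (g0 u q i) s) := by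
      refine intervalIntegral.integral_mono_on_of_le_Ioo hct ?_ ?_ fun s hs => ?_
      · exact ((ph_cont c k).mul (((h.hu i).Dt (k + 1)).Nm_cont (by lia))).intervalIntegrable _ _
      · exact (((c2 k i).const_mul _).add (cg k i)).intervalIntegrable _ _
      · have := mul_le_mul_of_nonneg_left
          (h.Nm_step hν k i (s := s) ⟨hc.trans_lt hs.1, hs.2.trans_le ht⟩) (ph_nonneg k hs.1.le)
        unfold M
        linarith
    have h3 : ∫ s in c..t, (M c 0 (k + 1) (g0 u q i) s + 4 * Real.pi ^ 2 * ν * M c 2 k (u i) s +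
        M c 0 k (g0 u q i) s) = (∫ s in c..t, M c 0 (k + 1) (g0 u q i) s) +
        ∫ s in c..t, (4 * Real.pi ^ 2 * ν * M c 2 k (u i) s + M c 0 k (g0 u q i) s) := by
      rw [← intervalIntegral.integral_add]
      · simp only [add_assoc]
      · exact (cg (k + 1) i).intervalIntegrable _ _
      · exact (((c2 k i).const_mul _).add (cg k i)).intervalIntegrable _ _
    rw [h3]
    rw [h0] at h1
    unfold M at *
    linarith
  have e1 : (∫ s in c..t, (GS c (k + 1) u q s + 4 * Real.pi ^ 2 * ν * MS c 2 k u s + GS c k u q s)) =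
      ∑ i, ∫ s in c..t, (M c 0 (k + 1) (g0 u q i) s + 4 * Real.pi ^ 2 * ν * M c 2 k (u i) s +
        M c 0 k (g0 u q i) s) := by
    rw [← intervalIntegral.integral_finsetSum]
    · unfold MS GS
      simp only [Finset.sum_add_distrib, Finset.mul_sum]
    · exact fun i _ => (((cg (k + 1) i).add ((c2 k i).const_mul _)).add (cg k i)).intervalIntegrable _ _
  rw [e1]
  unfold MS
  rw [intervalIntegral.integral_finsetSum, Finset.mul_sum, ← Finset.sum_add_distrib]
  · exact Finset.sum_le_sum fun i _ => key i
  · exact fun i _ => (c2 (k + 1) i).intervalIntegrable _ _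

/-- Uniform analytic-type bounds. -/
theorem Sol.analytic (h : Sol ν K c0 d u q) (hν : 0 < ν) (hK : 0 < K) :
    ∃ A ρ T : ℝ, 0 < A ∧ 0 < ρ ∧ 0 < T ∧ ∀ c e, c0 ≤ c → e ≤ d → e - c ≤ T →
      ∀ t ∈ Set.Icc c e, ∀ k, ρ ^ k * MS c 0 k u t ≤ A := by
  have hπ := Real.pi_pos
  choose C hC using fun i => (h.hu i).Nm_bdd (r := 0) (by lia)
  obtain ⟨Q1, hQ1⟩ := h.hq.Nm_bdd (r := 1) (by lia)
  have hQ1' : 0 ≤ Q1 := (Nm_nonneg _ _ _).trans (hQ1 0)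
  set M0 := ∑ i, C i with hM0
  have hM0' : 0 ≤ M0 := Finset.sum_nonneg fun i _ => (Nm_nonneg _ _ _).trans (hC i 0)
  set A := M0 + 1 with hA
  have hApos : 0 < A := by linarith
  set m := 4 * Real.pi ^ 2 * ν with hm
  have hmpos : 0 < m := by positivity
  set P := 3 * Real.pi with hP
  have hPpos : 0 < P := by positivity
  set L := 12 * Real.pi ^ 2 * K with hL
  have hLpos : 0 < L := by positivity
  set Q := 6 * Real.pi * Q1 with hQ
  have hQnn : 0 ≤ Q := by positivity
  set δ := m / (16 * P * A) with hδ
  have hδpos : 0 < δ := by positivity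
  set ρ := min 1 (m / (4 * (2 * L + m))) with hρ
  have hρpos : 0 < ρ := by positivity
  set T := min 1 (1 / (2 * (8 * P * A ^ 2 * δ⁻¹ + 2 * Q))) with hT
  have hX : 0 < 8 * P * A ^ 2 * δ⁻¹ + 2 * Q := by positivity
  have hTpos : 0 < T := by positivity
  refine ⟨2 * A, ρ, T, by positivity, hρpos, hTpos, fun c e hc he hce t ht k => ?_⟩
  have hT1 : T ≤ 1 := min_le_left _ _
  have := hier (α := fun k => MS c 0 k u) (β := fun k => MS c 2 k u) (γ := fun k => MS c 1 k u)
    (G := fun k => GS c k u q) (c := c) (e := e) (m := m) (P := P) (L := L) (Q := Q) (M0 := M0)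
    (A := A) (δ := δ) (ρ := ρ) (T := T)
    (fun k => MS_cont c (by lia) k h.hu) (fun k => MS_cont c (by lia) k h.hu)
    (fun k => GS_cont c k h.hu h.hq)
    (fun k s hs => MS_nonneg _ _ _ hs) (fun k s hs => MS_nonneg _ _ _ hs)
    (fun k s hs => MS_nonneg _ _ _ hs) (fun k s hs => GS_nonneg _ _ _ hs)
    ?_ (fun t ht => h.est0 hν.le hc ht.1 (ht.2.trans he))
    (fun k t ht => h.estk hν.le k hc ht.1 (ht.2.trans he)) ?_ ?_ hmpos.le hPpos.le hLpos.le hQnn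
    ?_ hM0' hA hδpos hρpos.le (min_le_left _ _) ?_ hce ?_ k t ht
  · refine le_trans ?_ this.le
    refine Finset.single_le_sum (f := fun k => ρ ^ k * MS c 0 k u t) (fun j _ => ?_)
      (Finset.self_mem_range_succ k)
    exact mul_nonneg (by positivity) (MS_nonneg _ _ _ ht.1)
  · intro k s hs
    simp only [MS, Finset.mul_sum, ← Finset.sum_add_distrib]
    refine Finset.sum_le_sum fun i _ => ?_
    unfold M
    have := mul_le_mul_of_nonneg_left (Nm_interp ((h.hu i).Dt k) s hδpos) (ph_nonneg k hs)
    linarith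
  · intro s hs
    have h1 := GS_le hs.1.le h.hu h.hq 0
    have h2 : M c 1 0 q s ≤ Q1 := by
      have := hQ1 s
      simpa [M, ph, Dt_zero] using this
    simp at h1
    have : 6 * Real.pi * M c 1 0 q s ≤ Q := by rw [hQ]; gcongr
    linarith
  · intro k s hs
    have h1 := GS_le hs.1.le h.hu h.hq (k + 1)
    have h2 := h.Mq hK.le k hs.1.le (by linarith [hs.2]) (s := s) ⟨hc.trans_lt hs.1, hs.2.trans_le he⟩
    have h3 : 6 * Real.pi * M c 1 (k + 1) q s ≤ 6 * Real.pi * (2 * Real.pi * K * MS c 2 k u s) := by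
      gcongr
    have h4 : 6 * Real.pi * (2 * Real.pi * K * MS c 2 k u s) = L * MS c 2 k u s := by
      rw [hL]; ring
    linarith
  · refine Finset.sum_le_sum fun i _ => ?_
    have := hC i c
    simpa [M, ph, Dt_zero] using this
  · have h1 : 4 * P * A * δ = m / 4 := by rw [hδ]; field_simp; norm_num
    have h2 : ρ * (2 * L + m) ≤ m / 4 := by
      calc _ ≤ m / (4 * (2 * L + m)) * (2 * L + m) := by gcongr; exact min_le_right _ _
        _ = m / 4 := by field_simp
    linarith
  · calc _ ≤ 1 / (2 * (8 * P * A ^ 2 * δ⁻¹ + 2 * Q)) * (8 * P * A ^ 2 * δ⁻¹ + 2 * Q) := by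
          gcongr; exact min_le_right _ _
      _ = 1 / 2 := by
          generalize 8 * P * A ^ 2 * δ⁻¹ + 2 * Q = X at hX
          field_simp

lemma Sol.abs_le (h : Sol ν K c0 d u q) (hν : 0 < ν) (hK : 0 < K) {t0} (ht0 : t0 ∈ Set.Ioc c0 d) :
    ∃ A L ε : ℝ, 0 < L ∧ 0 < ε ∧ ∀ k i x, ∀ t ∈ Set.Ioo (t0 - ε) (t0 + ε) ∩ Set.Icc c0 d,
      |Dt k (u i) (x, t)| ≤ A * L ^ k * k.factorial := by
  obtain ⟨A, ρ, T, hA, hρ, hT, H⟩ := h.analytic hν hK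
  set c := max c0 (t0 - T / 2) with hc
  have hct : c < t0 := max_lt ht0.1 (by linarith)
  set η := t0 - c with hη
  have hηpos : 0 < η := by linarith
  have hηT : η ≤ T / 2 := by have := le_max_right c0 (t0 - T / 2); linarith
  refine ⟨A, 2 / (ρ * η), η / 2, by positivity, by positivity, fun k i x t ht => ?_⟩
  have hlow : t - c ≥ η / 2 := by have := ht.1.1; linarith
  have h1 := H c (min d (c + T)) (le_max_left _ _) (min_le_left _ _)
    (by have := min_le_right d (c + T); linarith) t
    ⟨by linarith, le_min ht.2.2 (by have := ht.1.2; linarith)⟩ k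
  have hct' : c ≤ t := by linarith
  have h2 : M c 0 k (u i) t ≤ MS c 0 k u t :=
    Finset.single_le_sum (f := fun i => M c 0 k (u i) t) (fun j _ => M_nonneg _ _ _ hct')
      (Finset.mem_univ i)
  have h3 := abs_le_Nm ((h.hu i).Dt k) x t
  have h4 : ρ ^ k * (ph c k t * |Dt k (u i) (x, t)|) ≤ A := by
    refine le_trans ?_ h1
    have := ph_nonneg k hct'
    gcongr
    refine le_trans ?_ h2
    unfold M
    gcongr
  have h5 : (η / 2) ^ k / k.factorial ≤ ph c k t := by
    unfold ph; gcongr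
  have h6 : ρ ^ k * ((η / 2) ^ k / k.factorial * |Dt k (u i) (x, t)|) ≤ A := by
    refine le_trans ?_ h4
    gcongr
  have hf : (0:ℝ) < k.factorial := by positivity
  have h7 : ρ ^ k * ((η / 2) ^ k / k.factorial * |Dt k (u i) (x, t)|) =
      |Dt k (u i) (x, t)| * (ρ * η / 2) ^ k / k.factorial := by
    rw [show ρ * η / 2 = ρ * (η / 2) by ring, mul_pow]; field_simp
  rw [h7, div_le_iff₀ hf] at h6
  have h8 : A * (2 / (ρ * η)) ^ k * k.factorial = A * k.factorial / (ρ * η / 2) ^ k := by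
    rw [show 2 / (ρ * η) = (ρ * η / 2)⁻¹ by field_simp, inv_pow]; field_simp
  rw [h8, le_div_iff₀ (by positivity)]
  exact h6
end

end QI

namespace QI

lemma Dx_zero {f : E3 × ℝ → ℝ} {t R : ℝ} (hf : Differentiable ℝ f)
    (H : ∀ x, R < ‖x‖ → f (x, t) = 0) (j) : ∀ x, R < ‖x‖ → Dv (ex j) f (x, t) = 0 := by
  intro x hx
  rw [← fderiv_space hf]
  have : (fun y => f (y, t)) =ᶠ[nhds x] fun _ => 0 := by
    have ho : IsOpen {y : E3 | R < ‖y‖} := isOpen_lt continuous_const continuous_norm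
    filter_upwards [ho.mem_nhds hx] with y hy using H y hy
  rw [this.fderiv_eq]; simp

lemma Lp_zero {f : E3 × ℝ → ℝ} {t R : ℝ} (hf : Sm f)
    (H : ∀ x, R < ‖x‖ → f (x, t) = 0) : ∀ x, R < ‖x‖ → Lp f (x, t) = 0 := by
  intro x hx
  unfold Lp
  exact Finset.sum_eq_zero fun j _ => Dx_zero (hf.Dv _).diff (Dx_zero hf.diff H j) j x hx

/-- equality on an open slab extends to the closed slab -/
lemma eq_Icc {f g : E3 × ℝ → ℝ} (hf : Continuous f) (hg : Continuous g) {c d : ℝ} (hcd : c < d)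
    (H : ∀ x, ∀ s ∈ Set.Ioo c d, f (x, s) = g (x, s)) :
    ∀ x, ∀ s ∈ Set.Icc c d, f (x, s) = g (x, s) := by
  intro x s hs
  have h : Set.EqOn (fun s => f (x, s)) (fun s => g (x, s)) (Set.Ioo c d) := fun s hs => H x s hs
  have := h.closure (by fun_prop) (by fun_prop)
  rw [closure_Ioo hcd.ne] at this
  exact this hs

section
variable {ν K c d : ℝ} {u : Fin 3 → E3 × ℝ → ℝ} {q : E3 × ℝ → ℝ}

lemma Dt_g0_zero (hu : ∀ i, Sm (u i)) (hq : Sm q) {x t k} 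
    (H : ∀ m ≤ k, ∀ i, Dt m (u i) (x, t) = 0) (Hq : ∀ i, Dv (ex i) (Dt k q) (x, t) = 0) (i) :
    Dt k (g0 u q i) (x, t) = 0 := by
  have e1 : ∀ a b : Fin 3, ∀ w, Sm w → Dt k (fun z => u a z * w z) (x, t) = 0 := by
    intro a b w hw
    rw [Dt_mul (hu a) hw]
    refine Finset.sum_eq_zero fun p hp => ?_
    rw [H p.1 (by have := Finset.HasAntidiagonal.mem_antidiagonal.1 hp; lia)]; simp
  unfold g0
  rw [Dt_const_mul ((Sm.NL hu i).add (hq.Dv _)), Dt_add (Sm.NL hu i) (hq.Dv _), Dt_Dv hq.1]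
  simp only [Hq]
  unfold NL
  rw [Dt_sum _ fun j => ((hu j).mul ((hu i).Dv _)).add (((hu i).mul ((hu j).Dv _)).const_mul _)]
  simp only
  rw [Finset.sum_eq_zero fun j _ => ?_]
  · simp
  rw [Dt_add ((hu j).mul ((hu i).Dv _)) (((hu i).mul ((hu j).Dv _)).const_mul _),
    Dt_const_mul ((hu i).mul ((hu j).Dv _))]
  simp only
  rw [e1 j i _ ((hu i).Dv _), e1 i j _ ((hu j).Dv _)]
  simp

lemma Sol.Dt_zero_ext (h : Sol ν K c d u q) (hcd : c < d) {t R : ℝ} (ht : t ∈ Set.Icc c d)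
    (H : ∀ x, R < ‖x‖ → (∀ i, u i (x, t) = 0) ∧ q (x, t) = 0) (k : ℕ) :
    ∀ m ≤ k, ∀ x, R < ‖x‖ → (∀ i, Dt m (u i) (x, t) = 0) ∧ Dt m q (x, t) = 0 := by
  induction k with
  | zero => intro m hm; obtain rfl : m = 0 := by lia
            exact H
  | succ k ih =>
    intro m hm x hx
    rcases Nat.lt_or_ge m (k + 1) with hm' | hm'
    · exact ih m (by lia) x hx
    obtain rfl : m = k + 1 := by lia
    constructor
    · intro i
      have e := eq_Icc (f := Dv et (Dt k (u i)))
        (g := fun z => ν * Lp (Dt k (u i)) z + Dt k (g0 u q i) z)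
        (((h.hu i).Dt k).Dv _).cont
        ((((h.hu i).Dt k).Lp.const_mul ν).add ((Sm.g0 h.hu h.hq i).Dt k)).cont hcd
        (fun x s hs => h.momk k i x s hs) x t ht
      rw [Dt_succ, e]
      rw [Lp_zero ((h.hu i).Dt k) (fun x hx => (ih k le_rfl x hx).1 i) x hx,
        Dt_g0_zero h.hu h.hq (fun m hm i => (ih m hm x hx).1 i)
          (fun j => Dx_zero (h.hq.Dt k).diff (fun x hx => (ih k le_rfl x hx).2) j x hx)]
      simp
    · have e := eq_Icc (f := Dt (k + 1) q)
        (g := fun z => (-K) * ∑ j, Dv (ex j) (Dt k (u j)) z)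
        (h.hq.Dt (k + 1)).cont
        ((Sm.sum _ fun j => ((h.hu j).Dt k).Dv _).const_mul _).cont hcd
        (fun x s hs => h.massk k x s hs) x t ht
      rw [e]
      rw [Finset.sum_eq_zero fun j _ => ?_]
      · simp
      exact Dx_zero ((h.hu j).Dt k).diff (fun x hx => (ih k le_rfl x hx).1 j) j x hx

lemma taylor_zero {f : ℝ → ℝ} (hf : ContDiff ℝ (⊤ : ℕ∞) f) {t0 t A L : ℝ} (hL : 0 < L)
    (h0 : ∀ k, iteratedDeriv k f t0 = 0)
    (hb : ∀ k, ∀ s ∈ Set.uIcc t0 t, |iteratedDeriv k f s| ≤ A * L ^ k * k.factorial)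
    (hs : L * |t - t0| ≤ 1 / 2) : f t = 0 := by
  rcases eq_or_ne t0 t with rfl | hne
  · simpa using h0 0
  have hA : 0 ≤ A := by
    have := (abs_nonneg _).trans (hb 0 t0 Set.left_mem_uIcc); simpa using this
  have key : ∀ n : ℕ, |f t| ≤ A * (1 / 2) ^ (n + 1) := by
    intro n
    obtain ⟨y, hy, e⟩ := taylor_mean_remainder_lagrange_iteratedDeriv (f := f) (n := n) hne
      ((hf.of_le (by exact_mod_cast le_top)).contDiffOn)
    have hud : UniqueDiffOn ℝ (Set.uIcc t0 t) :=
      uniqueDiffOn_Icc (by simpa using hne.symm)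
    rw [taylor_within_apply, Finset.sum_eq_zero, sub_zero] at e
    · rw [e, abs_div, abs_mul, abs_pow, Nat.abs_cast, div_le_iff₀ (by positivity)]
      have h1 := hb (n + 1) y (Set.Ioo_subset_Icc_self hy)
      calc _ ≤ (A * L ^ (n + 1) * (n + 1).factorial) * |t - t0| ^ (n + 1) := by gcongr
        _ = A * (L * |t - t0|) ^ (n + 1) * (n + 1).factorial := by rw [mul_pow]; ring
        _ ≤ _ := by gcongr
    · intro k hk
      rw [iteratedDerivWithin_eq_iteratedDeriv hud
        ((hf.of_le (by exact_mod_cast le_top)).contDiffAt) Set.left_mem_uIcc, h0, smul_zero]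
  have hlim : Filter.Tendsto (fun n : ℕ => A * (1 / 2 : ℝ) ^ (n + 1)) Filter.atTop (nhds (A * 0)) :=
    ((tendsto_pow_atTop_nhds_zero_of_lt_one (by norm_num) (by norm_num)).comp
      (Filter.tendsto_add_atTop_nat 1)).const_mul A
  have := ge_of_tendsto' hlim key
  rw [mul_zero] at this
  exact abs_eq_zero.1 (le_antisymm this (abs_nonneg _))

lemma Sol.local_zero (h : Sol ν K c d u q) (hν : 0 < ν) (hK : 0 < K) {t0 R : ℝ}
    (ht0 : t0 ∈ Set.Ioc c d) (H : ∀ x, R < ‖x‖ → (∀ i, u i (x, t0) = 0) ∧ q (x, t0) = 0) :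
    ∃ ε > 0, ∀ t ∈ Set.Ioo (t0 - ε) (t0 + ε) ∩ Set.Icc c d, ∀ x, R < ‖x‖ →
      (∀ i, u i (x, t) = 0) ∧ q (x, t) = 0 := by
  have hcd : c < d := ht0.1.trans_le ht0.2
  have ht0' : t0 ∈ Set.Icc c d := ⟨ht0.1.le, ht0.2⟩
  obtain ⟨A, L, ε, hL, hε, hb⟩ := h.abs_le hν hK ht0
  set η := min ε (1 / (2 * L)) with hη
  have hηpos : 0 < η := by positivity
  have hηε : η ≤ ε := min_le_left _ _
  have hux : ∀ t ∈ Set.Ioo (t0 - η) (t0 + η) ∩ Set.Icc c d, ∀ x, R < ‖x‖ → ∀ i, u i (x, t) = 0 := by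
    intro t ht x hx i
    have hc : ContDiff ℝ (⊤ : ℕ∞) (fun s : ℝ => u i (x, s)) := (h.hu i).1.comp (by fun_prop)
    refine taylor_zero (f := fun s => u i (x, s)) (A := A) hc hL (t0 := t0) ?_ ?_ ?_
    · intro k
      rw [iteratedDeriv_time (h.hu i).1]
      exact (h.Dt_zero_ext hcd ht0' H k k le_rfl x hx).1 i
    · intro k s hs
      rw [iteratedDeriv_time (h.hu i).1]
      refine hb k i x s ⟨?_, ?_⟩
      · have hoc : Set.OrdConnected (Set.Ioo (t0 - ε) (t0 + ε)) := Set.ordConnected_Ioo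
        refine hoc.uIcc_subset ?_ ?_ hs
        · constructor <;> linarith
        · constructor <;> linarith [ht.1.1, ht.1.2]
      · exact (Set.ordConnected_Icc (a := c) (b := d)).uIcc_subset ht0' ht.2 hs
    · have h1 : |t - t0| ≤ 1 / (2 * L) := by
        refine le_trans ?_ (min_le_right ε _)
        rw [_root_.abs_le]; constructor <;> linarith [ht.1.1, ht.1.2]
      calc _ ≤ L * (1 / (2 * L)) := by gcongr
        _ = 1 / 2 := by field_simp
  refine ⟨η, hηpos, fun t ht x hx => ⟨hux t ht x hx, ?_⟩⟩
  have hm := eq_Icc (f := Dv et q) (g := fun z => (-K) * ∑ j, Dv (ex j) (u j) z)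
    (h.hq.Dv _).cont ((Sm.sum _ fun j => (h.hu j).Dv _).const_mul _).cont hcd h.mass
  have hconv : Convex ℝ (Set.Ioo (t0 - η) (t0 + η) ∩ Set.Icc c d) :=
    (convex_Ioo _ _).inter (convex_Icc _ _)
  have := hconv.norm_image_sub_le_of_norm_hasDerivWithin_le (f := fun s => q (x, s))
    (f' := fun s => Dv et q (x, s)) (C := 0) (x := t0) (y := t)
    (fun s hs => (hasDerivAt_time h.hq.diff x s).hasDerivWithinAt)
    (fun s hs => by
      rw [hm x s hs.2]
      rw [Finset.sum_eq_zero fun j _ => ?_]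
      · simp
      exact Dx_zero (h.hu j).diff (fun x hx => hux s hs x hx j) j x hx)
    ⟨⟨by linarith, by linarith⟩, ht0'⟩ ht
  simp only [zero_mul, norm_le_zero_iff] at this
  rw [(H x hx).2, sub_zero] at this
  exact this

/-- global smooth solutions -/
structure GSol (ν K : ℝ) (u : Fin 3 → E3 × ℝ → ℝ) (q : E3 × ℝ → ℝ) : Prop where
  hu : ∀ i, ContDiff ℝ (⊤ : ℕ∞) (u i)
  hq : ContDiff ℝ (⊤ : ℕ∞) q
  mom : ∀ i z, Dv et (u i) z = ν * Lp (u i) z + g0 u q i z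
  mass : ∀ z, Dv et q z = (-K) * ∑ j, Dv (ex j) (u j) z

/-- times at which the fields are supported in the ball of radius `n` -/
def TT (u : Fin 3 → E3 × ℝ → ℝ) (q : E3 × ℝ → ℝ) (n : ℕ) : Set ℝ :=
  {t | ∀ x, (n : ℝ) < ‖x‖ → (∀ i, u i (x, t) = 0) ∧ q (x, t) = 0}

lemma GSol.cutoff (h : GSol ν K u q) {R : ℕ} (hR : Set.Icc c d ⊆ TT u q R) :
    ∃ u' q', Sol ν K c d u' q' ∧
      ∀ x, ∀ s ∈ Set.Icc c d, (∀ i, u' i (x, s) = u i (x, s)) ∧ q' (x, s) = q (x, s) := by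
  let χ : ContDiffBump (0 : E3) := ⟨R + 1, R + 2, by positivity, by linarith⟩
  let φ : ContDiffBump ((c + d) / 2 : ℝ) := ⟨|d - c| + 1, |d - c| + 2, by positivity, by linarith⟩
  let ψ : E3 × ℝ → ℝ := fun z => χ z.1 * φ z.2
  have hψ1 : ContDiff ℝ (⊤ : ℕ∞) ψ :=
    (χ.contDiff.comp contDiff_fst).mul (φ.contDiff.comp contDiff_snd)
  have hψ2 : HasCompactSupport ψ := by
    refine HasCompactSupport.intro (χ.hasCompactSupport.isCompact.prod φ.hasCompactSupport.isCompact)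
      fun z hz => ?_
    by_contra hne
    have h1 : χ z.1 ≠ 0 := fun e => hne (by simp [ψ, e])
    have h2 : φ z.2 ≠ 0 := fun e => hne (by simp [ψ, e])
    exact hz ⟨subset_tsupport _ h1, subset_tsupport _ h2⟩
  have hsm : ∀ w, ContDiff ℝ (⊤ : ℕ∞) w → Sm (fun z => ψ z * w z) := fun w hw =>
    ⟨hψ1.mul hw, hψ2.mul_right⟩
  have hφ : ∀ s ∈ Set.Icc c d, φ s = 1 := by
    intro s hs
    refine φ.one_of_mem_closedBall ?_
    rw [Metric.mem_closedBall, Real.dist_eq]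
    show _ ≤ |d - c| + 1
    have := le_abs_self (d - c)
    have := abs_nonneg (d - c)
    rw [abs_le]; constructor <;> linarith [hs.1, hs.2]
  have heq : ∀ x, ∀ s ∈ Set.Icc c d,
      (∀ i, ψ (x, s) * u i (x, s) = u i (x, s)) ∧ ψ (x, s) * q (x, s) = q (x, s) := by
    intro x s hs
    rcases le_or_gt ‖x‖ R with hx | hx
    · have : χ x = 1 := by
        refine χ.one_of_mem_closedBall ?_
        rw [mem_closedBall_zero_iff]
        show _ ≤ (R : ℝ) + 1
        linarith
      simp [ψ, this, hφ s hs]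
    · have := hR hs x hx
      simp [this]
  have hI := fun x s (hs : s ∈ Set.Ioo c d) => heq x s (Set.Ioo_subset_Icc_self hs)
  have cu : ∀ i, ∀ x, ∀ s ∈ Set.Ioo c d, (fun z => ψ z * u i z) (x, s) = u i (x, s) :=
    fun i x s hs => (hI x s hs).1 i
  have cq : ∀ x, ∀ s ∈ Set.Ioo c d, (fun z => ψ z * q z) (x, s) = q (x, s) :=
    fun x s hs => (hI x s hs).2
  refine ⟨fun i z => ψ z * u i z, fun z => ψ z * q z, ⟨fun i => hsm _ (h.hu i), hsm _ h.hq, ?_, ?_⟩,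
    heq⟩
  · intro i x s hs
    have hL : Lp (fun z => ψ z * u i z) (x, s) = Lp (u i) (x, s) := by
      unfold Lp
      exact Finset.sum_congr rfl fun j _ => Dv_congr (Dv_congr (cu i) _) _ x s hs
    have hg : g0 (fun i z => ψ z * u i z) (fun z => ψ z * q z) i (x, s) = g0 u q i (x, s) := by
      unfold g0 NL
      rw [Dv_congr cq _ x s hs]
      congr 2
      refine Finset.sum_congr rfl fun j _ => ?_
      rw [Dv_congr (h := u i) (cu i) _ x s hs, Dv_congr (f := fun z => ψ z * u j z) (h := u j) (cu j) _ x s hs]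
      simp only [(hI x s hs).1]
    rw [hL, hg, Dv_congr (cu i) _ x s hs, h.mom]
  · intro x s hs
    rw [Dv_congr cq _ x s hs, h.mass]
    congr 1
    exact Finset.sum_congr rfl fun j _ => (Dv_congr (cu j) _ x s hs).symm

lemma GSol.TT_closed (h : GSol ν K u q) (n) : IsClosed (TT u q n) := by
  have : TT u q n = ⋂ x : E3, ⋂ _ : (n : ℝ) < ‖x‖, {t | (∀ i, u i (x, t) = 0) ∧ q (x, t) = 0} := by
    ext t; simp [TT]
  rw [this]
  refine isClosed_iInter fun x => isClosed_iInter fun _ => ?_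
  have e : {t | (∀ i, u i (x, t) = 0) ∧ q (x, t) = 0} =
      (⋂ i, {t | u i (x, t) = 0}) ∩ {t | q (x, t) = 0} := by ext t; simp
  rw [e]
  have hc := fun i => (h.hu i).continuous
  have hc2 := h.hq.continuous
  refine (isClosed_iInter fun i => isClosed_eq ?_ continuous_const).inter
    (isClosed_eq ?_ continuous_const)
  · have := hc i; fun_prop
  · fun_prop

lemma TT_mono : Monotone (TT u q) := by
  intro m n hmn t ht x hx
  exact ht x (lt_of_le_of_lt (by exact_mod_cast hmn) hx)

lemma GSol.prop (h : GSol ν K u q) (hν : 0 < ν) (hK : 0 < K) (c d : ℝ) (R m : ℕ) (hcd : c < d)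
    (hR : Set.Icc c d ⊆ TT u q R) (hm : ∃ t ∈ Set.Ioc c d, t ∈ TT u q m) :
    Set.Icc c d ⊆ TT u q m := by
  obtain ⟨u', q', hS, he⟩ := h.cutoff hR
  have loc : ∀ t, t ∈ Set.Ioc c d → t ∈ TT u q m → ∃ ε > 0,
      Set.Ioo (t - ε) (t + ε) ∩ Set.Icc c d ⊆ TT u q m := by
    intro t ht htm
    obtain ⟨ε, hε, H⟩ := hS.local_zero hν hK (R := m) ht (fun x hx => by
      have e := he x t ⟨ht.1.le, ht.2⟩
      have := htm x hx
      exact ⟨fun i => (e.1 i).trans (this.1 i), e.2.trans this.2⟩)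
    refine ⟨ε, hε, fun s hs x hx => ?_⟩
    have e := he x s hs.2
    have := H s hs x hx
    exact ⟨fun i => (e.1 i).symm.trans (this.1 i), e.2.symm.trans this.2⟩
  choose! ε hε hsub using loc
  set U : Set ℝ := ⋃ t : ℝ, ⋃ _ : t ∈ Set.Ioc c d ∩ TT u q m, Set.Ioo (t - ε t) (t + ε t) with hU
  have hUo : IsOpen U := isOpen_iUnion fun t => isOpen_iUnion fun _ => isOpen_Ioo
  have hUm : ∀ t ∈ Set.Ioc c d, t ∈ TT u q m → t ∈ U := fun t ht htm => by
    have := hε t ht htm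
    refine Set.mem_iUnion.2 ⟨t, Set.mem_iUnion.2 ⟨⟨ht, htm⟩, ?_⟩⟩
    constructor <;> linarith
  have key : Set.Ioc c d ⊆ TT u q m := by
    by_contra hn
    obtain ⟨s, hs, hsn⟩ := Set.not_subset.1 hn
    obtain ⟨t, ht, htm⟩ := hm
    obtain ⟨r, hr, hrU, hrV⟩ := (isPreconnected_Ioc (a := c) (b := d)) U (TT u q m)ᶜ hUo
      (h.TT_closed m).isOpen_compl
      (fun r hr => (em (r ∈ TT u q m)).imp (hUm r hr) id)
      ⟨t, ht, hUm t ht htm⟩ ⟨s, hs, hsn⟩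
    obtain ⟨r', hr'⟩ := Set.mem_iUnion.1 hrU
    obtain ⟨hr1, hr2⟩ := Set.mem_iUnion.1 hr'
    exact hrV (hsub r' hr1.1 hr1.2 ⟨hr2, hr.1.le, hr.2⟩)
  rw [← closure_Ioc hcd.ne]
  exact (h.TT_closed m).closure_subset_iff.2 key
end
end QI

namespace QI

section Baire
variable {T : ℕ → Set ℝ}

/-- points with locally uniform support -/
def UU (T : ℕ → Set ℝ) : Set ℝ := {t | ∃ ε > 0, ∃ n, Set.Icc (t - ε) (t + ε) ⊆ T n}

lemma UU_open : IsOpen (UU T) := by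
  rw [Metric.isOpen_iff]
  rintro t ⟨ε, hε, n, h⟩
  refine ⟨ε / 2, by positivity, fun s hs => ⟨ε / 2, by positivity, n, fun r hr => h ?_⟩⟩
  rw [Metric.mem_ball, Real.dist_eq, abs_lt] at hs
  constructor <;> linarith [hr.1, hr.2]

lemma UU_compact
    (hmono : Monotone T) {a b : ℝ} (h : Set.Icc a b ⊆ UU T) : ∃ R, Set.Icc a b ⊆ T R := by
  refine isCompact_Icc.induction_on (p := fun s => ∃ R, s ⊆ T R) ⟨0, by simp⟩ ?_ ?_ ?_
  · rintro s t hst ⟨R, hR⟩; exact ⟨R, hst.trans hR⟩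
  · rintro s t ⟨R, hR⟩ ⟨R', hR'⟩
    exact ⟨max R R', Set.union_subset (hR.trans (hmono (le_max_left _ _)))
      (hR'.trans (hmono (le_max_right _ _)))⟩
  · intro x hx
    obtain ⟨ε, hε, n, hn⟩ := h hx
    exact ⟨Set.Icc (x - ε) (x + ε), mem_nhdsWithin_of_mem_nhds
      (Icc_mem_nhds (by linarith) (by linarith)), n, hn⟩

lemma gap
    (hcl : ∀ n, IsClosed (T n))
    (hmono : Monotone T)
    (hun : ∀ t, ∃ n, t ∈ T n)
    (hP : ∀ c d : ℝ, ∀ R m : ℕ, c < d → Set.Icc c d ⊆ T R → (∃ t ∈ Set.Ioc c d, t ∈ T m) →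
      Set.Icc c d ⊆ T m) {a b : ℝ} (hab : a < b) (h : Set.Ioo a b ⊆ UU T) :
    ∃ R, Set.Icc a b ⊆ T R ∧ ∀ m, b ∈ T m → Set.Icc a b ⊆ T m := by
  obtain ⟨R, hR⟩ := hun ((a + b) / 2)
  have key : Set.Ioo a b ⊆ T R := by
    intro t ht
    set c := min ((a + t) / 2) ((a + (a + b) / 2) / 2) with hc
    set d := max t ((a + b) / 2) with hd
    have hac : a < c := lt_min (by linarith [ht.1]) (by linarith)
    have hct : c < t := (min_le_left _ _).trans_lt (by linarith [ht.1])
    have hcm : c < (a + b) / 2 := (min_le_right _ _).trans_lt (by linarith)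
    have hdb : d < b := max_lt ht.2 (by linarith)
    have htd : t ≤ d := le_max_left _ _
    have hmd : (a + b) / 2 ≤ d := le_max_right _ _
    obtain ⟨R', hR'⟩ := UU_compact hmono (a := c) (b := d)
      (fun s hs => h ⟨hac.trans_le hs.1, hs.2.trans_lt hdb⟩)
    exact hP c d R' R (hct.trans_le htd) hR' ⟨_, ⟨hcm, hmd⟩, hR⟩ ⟨hct.le, htd⟩
  have key2 : Set.Icc a b ⊆ T R := by
    rw [← closure_Ioo hab.ne]; exact (hcl R).closure_subset_iff.2 key
  exact ⟨R, key2, fun m hm => hP a b R m hab key2 ⟨b, ⟨hab, le_rfl⟩, hm⟩⟩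

lemma fill
    (hcl : ∀ n, IsClosed (T n))
    (hmono : Monotone T)
    (hun : ∀ t, ∃ n, t ∈ T n)
    (hP : ∀ c d : ℝ, ∀ R m : ℕ, c < d → Set.Icc c d ⊆ T R → (∃ t ∈ Set.Ioc c d, t ∈ T m) →
      Set.Icc c d ⊆ T m) {n : ℕ} {a b : ℝ} (ha : a ∉ UU T) (hb : b ∉ UU T)
    (h : ∀ e ∈ Set.Icc a b, e ∉ UU T → e ∈ T n) : Set.Icc a b ⊆ T n := by
  intro t ht
  by_cases htU : t ∈ UU T
  swap
  · exact h t ht htU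
  have hC : IsClosed (UU T)ᶜ := UU_open.isClosed_compl
  obtain ⟨b', hb', hb2⟩ := (isCompact_Icc.inter_right hC (s := Set.Icc t b)).exists_isLeast
    ⟨b, ⟨ht.2, le_rfl⟩, hb⟩
  obtain ⟨a', ha', ha2⟩ := (isCompact_Icc.inter_right hC (s := Set.Icc a t)).exists_isGreatest
    ⟨a, ⟨le_rfl, ht.1⟩, ha⟩
  have h1 : a' < t := lt_of_le_of_ne ha'.1.2 (fun e => ha'.2 (e ▸ htU))
  have h2 : t < b' := lt_of_le_of_ne hb'.1.1 (fun e => hb'.2 (e ▸ htU))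
  obtain ⟨R, -, hR⟩ := gap hcl hmono hun hP (h1.trans h2) (fun s hs => by
    by_contra hsU
    rcases le_total s t with hst | hst
    · exact absurd (ha2 ⟨⟨ha'.1.1.trans hs.1.le, hst⟩, hsU⟩) (not_le.2 hs.1)
    · exact absurd (hb2 ⟨⟨hst, hs.2.le.trans hb'.1.2⟩, hsU⟩) (not_le.2 hs.2))
  exact hR n (h b' ⟨ht.1.trans hb'.1.1, hb'.1.2⟩ hb'.2) ⟨h1.le, h2.le⟩

theorem all_UU
    (hcl : ∀ n, IsClosed (T n))
    (hmono : Monotone T)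
    (hun : ∀ t, ∃ n, t ∈ T n)
    (hP : ∀ c d : ℝ, ∀ R m : ℕ, c < d → Set.Icc c d ⊆ T R → (∃ t ∈ Set.Ioc c d, t ∈ T m) →
      Set.Icc c d ⊆ T m) (t : ℝ) : t ∈ UU T := by
  by_contra ht
  have hC : IsClosed (UU T)ᶜ := UU_open.isClosed_compl
  have : CompleteSpace ((UU T)ᶜ : Set ℝ) := hC.completeSpace_coe
  have : Nonempty ((UU T)ᶜ : Set ℝ) := ⟨⟨t, ht⟩⟩
  obtain ⟨n, ⟨e0, he0⟩, hinter⟩ := nonempty_interior_of_iUnion_of_closed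
    (f := fun n => ((↑) : ((UU T)ᶜ : Set ℝ) → ℝ) ⁻¹' T n)
    (fun n => (hcl n).preimage continuous_subtype_val)
    (by ext x; simpa using hun x)
  rw [mem_interior_iff_mem_nhds, Metric.mem_nhds_iff] at hinter
  obtain ⟨δ, hδ, hb⟩ := hinter
  have hn : ∀ e, e ∉ UU T → |e - e0| < δ → e ∈ T n := fun e he hd =>
    hb (show (⟨e, he⟩ : ((UU T)ᶜ : Set ℝ)) ∈ _ by
      rw [Metric.mem_ball, Subtype.dist_eq, Real.dist_eq]; exact hd)
  have right : ∃ η > 0, ∃ m, Set.Icc e0 (e0 + η) ⊆ T m := by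
    by_cases h : Set.Ioo e0 (e0 + δ) ⊆ UU T
    · obtain ⟨R, hR, -⟩ := gap hcl hmono hun hP (by linarith) h
      exact ⟨δ, hδ, R, hR⟩
    · obtain ⟨e1, he1, he1U⟩ := Set.not_subset.1 h
      refine ⟨e1 - e0, by linarith [he1.1], n, ?_⟩
      rw [add_sub_cancel]
      exact fill hcl hmono hun hP he0 he1U fun e he heU => hn e heU
        (by rw [abs_lt]; constructor <;> linarith [he.1, he.2, he1.2])
  have left : ∃ η > 0, ∃ m, Set.Icc (e0 - η) e0 ⊆ T m := by
    by_cases h : Set.Ioo (e0 - δ) e0 ⊆ UU T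
    · obtain ⟨R, hR, -⟩ := gap hcl hmono hun hP (by linarith) h
      exact ⟨δ, hδ, R, hR⟩
    · obtain ⟨e1, he1, he1U⟩ := Set.not_subset.1 h
      refine ⟨e0 - e1, by linarith [he1.2], n, ?_⟩
      rw [sub_sub_cancel]
      exact fill hcl hmono hun hP he1U he0 fun e he heU => hn e heU
        (by rw [abs_lt]; constructor <;> linarith [he.1, he.2, he1.1])
  obtain ⟨η, hη, m, h1⟩ := right
  obtain ⟨η', hη', m', h2⟩ := left
  refine he0 ⟨min η η', lt_min hη hη', max m m', fun s hs => ?_⟩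
  have := min_le_left η η'; have := min_le_right η η'
  rcases le_total s e0 with h | h
  · exact hmono (le_max_right _ _) (h2 ⟨by linarith [hs.1], h⟩)
  · exact hmono (le_max_left _ _) (h1 ⟨h, by linarith [hs.2]⟩)
end Baire
end QI

namespace QI

lemma Sm.integral_hasDerivAt {w} (hw : Sm w) (t) :
    HasDerivAt (fun s => ∫ x : E3, w (x, s)) (∫ x : E3, QI.Dv et w (x, t)) t := by
  obtain ⟨g, hg, hb⟩ := (hw.Dv et).dom
  exact (hasDerivAt_integral_of_dominated_loc_of_deriv_le (s := Set.univ) (bound := g)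
    (F := fun s x => w (x, s)) (F' := fun s x => QI.Dv et w (x, s)) Filter.univ_mem
    (Filter.Eventually.of_forall fun s => (hw.slice_cont s).aestronglyMeasurable)
    (hw.slice_int t) ((hw.Dv et).slice_cont t).aestronglyMeasurable
    (Filter.Eventually.of_forall fun x s _ => hb x s) hg
    (Filter.Eventually.of_forall fun x s _ => hasDerivAt_time hw.diff x s)).2

lemma Sm.integral_Dx {w} (hw : Sm w) (j t) : ∫ x : E3, QI.Dv (ex j) w (x, t) = 0 := by
  have h := hw.F_Dx j 0 t
  rw [F_eq] at h
  simp only [inner_zero_right, neg_zero, AddChar.map_zero_eq_one, one_smul] at h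
  rw [integral_complex_ofReal] at h
  simpa using h

/-- energy density -/
def en (K : ℝ) (u : Fin 3 → E3 × ℝ → ℝ) (q : E3 × ℝ → ℝ) : E3 × ℝ → ℝ := fun z =>
  (∑ i, (1 / 2) * (u i z * u i z)) + (1 / (2 * K)) * (q z * q z)

/-- energy flux -/
def fl (ν : ℝ) (u : Fin 3 → E3 × ℝ → ℝ) (q : E3 × ℝ → ℝ) (j : Fin 3) : E3 × ℝ → ℝ := fun z =>
  (∑ i, (ν * (u i z * Dv (ex j) (u i) z) + (-1 / 2) * ((u i z * u i z) * u j z))) +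
    (-1) * (q z * u j z)

/-- dissipation -/
def ds (u : Fin 3 → E3 × ℝ → ℝ) : E3 × ℝ → ℝ := fun z =>
  ∑ i, ∑ j, Dv (ex j) (u i) z * Dv (ex j) (u i) z

section
variable {ν K c d : ℝ} {u : Fin 3 → E3 × ℝ → ℝ} {q : E3 × ℝ → ℝ}

lemma Sm.en (hu : ∀ i, Sm (u i)) (hq : Sm q) : Sm (en K u q) :=
  (Sm.sum _ fun i => ((hu i).mul (hu i)).const_mul _).add ((hq.mul hq).const_mul _)
lemma Sm.fl (hu : ∀ i, Sm (u i)) (hq : Sm q) (j) : Sm (fl ν u q j) :=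
  (Sm.sum _ fun i => (((hu i).mul ((hu i).Dv _)).const_mul _).add
    ((((hu i).mul (hu i)).mul (hu j)).const_mul _)).add ((hq.mul (hu j)).const_mul _)
lemma Sm.ds (hu : ∀ i, Sm (u i)) : Sm (ds u) :=
  Sm.sum _ fun i => Sm.sum _ fun j => ((hu i).Dv _).mul ((hu i).Dv _)

lemma Dv_en (hu : ∀ i, Sm (u i)) (hq : Sm q) (e z) : Dv e (en K u q) z =
    (∑ i, u i z * Dv e (u i) z) + (1 / K) * (q z * Dv e q z) := by
  unfold en
  rw [Dv_add (Sm.sum _ fun i => ((hu i).mul (hu i)).const_mul _).diff ((hq.mul hq).const_mul _).diff,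
    Dv_sum _ fun i => (((hu i).mul (hu i)).const_mul _).diff, Dv_const_mul (hq.mul hq).diff,
    Dv_mul hq.diff hq.diff]
  simp only [Dv_const_mul ((hu _).mul (hu _)).diff, Dv_mul (hu _).diff (hu _).diff]
  congr 1
  · exact Finset.sum_congr rfl fun i _ => by ring
  · rw [one_div, one_div, mul_inv]; ring

lemma Dv_fl (hu : ∀ i, Sm (u i)) (hq : Sm q) (j e z) : Dv e (fl ν u q j) z =
    (∑ i, (ν * (Dv e (u i) z * Dv (ex j) (u i) z + u i z * Dv e (Dv (ex j) (u i)) z) +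
      (-1 / 2) * ((Dv e (u i) z * u i z + u i z * Dv e (u i) z) * u j z +
        (u i z * u i z) * Dv e (u j) z))) +
    (-1) * (Dv e q z * u j z + q z * Dv e (u j) z) := by
  unfold fl
  have h1 := fun i => ((hu i).mul ((hu i).Dv (ex j))).const_mul ν
  have h2 := fun i => (((hu i).mul (hu i)).mul (hu j)).const_mul (-1 / 2)
  rw [Dv_add (Sm.sum _ fun i => (h1 i).add (h2 i)).diff ((hq.mul (hu j)).const_mul _).diff,
    Dv_sum _ fun i => ((h1 i).add (h2 i)).diff, Dv_const_mul (hq.mul (hu j)).diff,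
    Dv_mul hq.diff (hu j).diff]
  simp only [Dv_add (h1 _).diff (h2 _).diff, Dv_const_mul ((hu _).mul ((hu _).Dv (ex j))).diff,
    Dv_const_mul (((hu _).mul (hu _)).mul (hu j)).diff, Dv_mul (hu _).diff ((hu _).Dv (ex j)).diff,
    Dv_mul ((hu _).mul (hu _)).diff (hu j).diff, Dv_mul (hu _).diff (hu _).diff]

lemma Sol.balance (h : Sol ν K c d u q) (hK : 0 < K) {t} (ht : t ∈ Set.Ioo c d) (x) :
    Dv et (en K u q) (x, t) = (∑ j, Dv (ex j) (fl ν u q j) (x, t)) + (-ν) * ds u (x, t) := by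
  rw [Dv_en h.hu h.hq]
  simp only [Dv_fl h.hu h.hq, h.mom _ x t ht, h.mass x t ht]
  unfold ds g0 NL Lp
  simp only [Fin.sum_univ_three]
  field_simp
  ring

lemma Sol.energy (h : Sol ν K c d u q) (hK : 0 < K) {t} (ht : t ∈ Set.Ioo c d) :
    HasDerivAt (fun s => ∫ x : E3, en K u q (x, s)) (-ν * ∫ x : E3, ds u (x, t)) t := by
  have h1 := (Sm.en (K := K) h.hu h.hq).integral_hasDerivAt t
  have hf := fun j => (Sm.fl (ν := ν) h.hu h.hq j)
  convert h1 using 1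
  rw [integral_congr_ae (Filter.Eventually.of_forall fun x => h.balance hK ht x)]
  rw [integral_add, integral_const_mul, integral_finsetSum]
  · simp [fun j => (hf j).integral_Dx j t]
  · exact fun j _ => ((hf j).Dv _).slice_int t
  · exact (Sm.sum _ fun j => (hf j).Dv (ex j)).slice_int t
  · exact ((Sm.ds h.hu).slice_int t).const_mul _

theorem GSol.energy (h : GSol ν K u q) (hν : 0 < ν) (hK : 0 < K) (hs : ∀ t, ∃ n, t ∈ TT u q n) (t) :
    HasDerivAt (fun s => ∫ x : E3, en K u q (x, s)) (-ν * ∫ x : E3, ds u (x, t)) t := by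
  obtain ⟨ε, hε, n, hn⟩ := all_UU h.TT_closed TT_mono hs (h.prop hν hK) t
  obtain ⟨u', q', hS, he⟩ := h.cutoff hn
  have ht : t ∈ Set.Ioo (t - ε) (t + ε) := ⟨by linarith, by linarith⟩
  have h1 := hS.energy hK ht
  have e1 : (fun s => ∫ x : E3, en K u q (x, s)) =ᶠ[nhds t] fun s => ∫ x : E3, en K u' q' (x, s) := by
    filter_upwards [Icc_mem_nhds ht.1 ht.2] with s hs
    congr 1; funext x
    simp only [en, (he x s hs).1, (he x s hs).2]
  have e2 : ∀ x, ds u' (x, t) = ds u (x, t) := by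
    intro x
    unfold ds
    refine Finset.sum_congr rfl fun i _ => Finset.sum_congr rfl fun j _ => ?_
    rw [Dv_congr (h := u i) (fun x s hs => (he x s (Set.Ioo_subset_Icc_self hs)).1 i) _ x t ht]
  simp only [e2] at h1
  exact h1.congr_of_eventuallyEq e1
end

section
variable {v : E3 → ℝ → E3}

/-- components -/
def co (v : E3 → ℝ → E3) (i : Fin 3) : E3 × ℝ → ℝ := fun z => v z.1 z.2 i

lemma co_smooth (hv : ContDiff ℝ (⊤ : ℕ∞) (fun q : E3 × ℝ => v q.1 q.2)) (i) :
    ContDiff ℝ (⊤ : ℕ∞) (co v i) :=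
  (EuclideanSpace.proj i : E3 →L[ℝ] ℝ).contDiff.comp hv

lemma fderiv_comp {f : E3 → E3} {x} (hf : DifferentiableAt ℝ f x) (w i) :
    (fderiv ℝ f x w) i = fderiv ℝ (fun y => f y i) x w := by
  have := ((EuclideanSpace.proj i : E3 →L[ℝ] ℝ).hasFDerivAt.comp x
    hf.hasFDerivAt).fderiv
  have e : (fun y => f y i) =
    (EuclideanSpace.proj i : E3 →L[ℝ] ℝ) ∘ f := rfl
  rw [e, this]; rfl

lemma slice_smooth (hv : ContDiff ℝ (⊤ : ℕ∞) (fun q : E3 × ℝ => v q.1 q.2)) (t) :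
    ContDiff ℝ (⊤ : ℕ∞) (fun y => v y t) := hv.comp (g := fun q : E3 × ℝ => v q.1 q.2)
      (f := fun y => (y, t)) (by fun_prop)

lemma fderiv_co (hv : ContDiff ℝ (⊤ : ℕ∞) (fun q : E3 × ℝ => v q.1 q.2)) (x t i j) :
    (fderiv ℝ (fun y => v y t) x (EuclideanSpace.single j 1)) i = Dv (ex j) (co v i) (x, t) := by
  rw [fderiv_comp ((slice_smooth hv t).differentiable (by simp) x)]
  exact fderiv_space ((co_smooth hv i).differentiable (by simp)) x t j

lemma lap_co (hv : ContDiff ℝ (⊤ : ℕ∞) (fun q : E3 × ℝ => v q.1 q.2)) (x t i) :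
    lap3 v x t i = Lp (co v i) (x, t) := by
  unfold lap3 Lp
  rw [WithLp.ofLp_sum, Finset.sum_apply]
  refine Finset.sum_congr rfl fun j _ => ?_
  rw [fderiv_comp]
  · simp only [fderiv_co hv]
    exact fderiv_space ((contDiff_Dv (co_smooth hv i) _).differentiable (by simp)) x t j
  · exact ((((slice_smooth hv t).fderiv_right (m := (⊤ : ℕ∞)) (by simp)).clm_apply
      contDiff_const).differentiable (by simp)) x

lemma div_co (hv : ContDiff ℝ (⊤ : ℕ∞) (fun q : E3 × ℝ => v q.1 q.2)) (x t) :
    div3 v x t = ∑ j, Dv (ex j) (co v j) (x, t) := by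
  unfold div3; simp only [fderiv_co hv]

lemma deriv_co (hv : ContDiff ℝ (⊤ : ℕ∞) (fun q : E3 × ℝ => v q.1 q.2)) (x t i) :
    deriv (fun s => v x s) t i = Dv et (co v i) (x, t) := by
  have h1 : ContDiff ℝ (⊤ : ℕ∞) (fun s => v x s) := hv.comp (g := fun q : E3 × ℝ => v q.1 q.2)
      (f := fun s => (x, s)) (by fun_prop)
  have h2 := ((EuclideanSpace.proj i : E3 →L[ℝ] ℝ).hasFDerivAt.comp_hasDerivAt
    t (h1.differentiable (by simp) t).hasDerivAt)
  exact h2.unique (hasDerivAt_time ((co_smooth hv i).differentiable (by simp)) x t)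

lemma grad_co {p : E3 → ℝ → ℝ} (hp : ContDiff ℝ (⊤ : ℕ∞) (fun q : E3 × ℝ => p q.1 q.2)) (x t i) :
    grad3 p x t i = Dv (ex i) (fun z => p z.1 z.2) (x, t) := by
  rw [← fderiv_space (hp.differentiable (by simp))]
  have : grad3 p x t i = ⟪grad3 p x t, EuclideanSpace.single i (1 : ℝ)⟫ := by
    rw [EuclideanSpace.inner_single_right]; simp
  rw [this]
  unfold grad3 gradient
  rw [InnerProductSpace.toDual_symm_apply]

lemma adv_co (hv : ContDiff ℝ (⊤ : ℕ∞) (fun q : E3 × ℝ => v q.1 q.2)) (x t i) :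
    (fderiv ℝ (fun y => v y t) x (v x t)) i = ∑ j, co v j (x, t) * Dv (ex j) (co v i) (x, t) := by
  have e : v x t = ∑ j, (v x t j) • EuclideanSpace.single j (1 : ℝ) := by
    ext k; simp [WithLp.ofLp_sum, Finset.sum_apply, Pi.single_apply]
  conv_lhs => rw [e]
  rw [map_sum, WithLp.ofLp_sum, Finset.sum_apply]
  refine Finset.sum_congr rfl fun j _ => ?_
  rw [map_smul, PiLp.smul_apply, fderiv_co hv]; rfl
end
end QI
open QI

/-- Energy balance for smooth, spatially compactly supported solutions of the
quasi-incompressible (Temam) Navier–Stokes system with zero body force. -/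
theorem quasi_incompressible_energy_balance
    (Re K : ℝ) (hRe : 0 < Re) (hK : 0 < K)
    (v : E3 → ℝ → E3) (p : E3 → ℝ → ℝ)
    (hv : ContDiff ℝ (⊤ : ℕ∞) (fun q : E3 × ℝ => v q.1 q.2))
    (hp : ContDiff ℝ (⊤ : ℕ∞) (fun q : E3 × ℝ => p q.1 q.2))
    (hvsupp : ∀ t, HasCompactSupport (fun x => v x t))
    (hpsupp : ∀ t, HasCompactSupport (fun x => p x t))
    (hmom : ∀ x t,
      deriv (fun s => v x s) t + fderiv ℝ (fun y => v y t) x (v x t) +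
          grad3 p x t - (1 / Re) • lap3 v x t =
        -((1 / 2 * div3 v x t) • v x t))
    (hmass : ∀ x t, (1 / K) * deriv (fun s => p x s) t + div3 v x t = 0) :
    (∀ t : ℝ,
      HasDerivAt (fun s => ∫ x : E3, (‖v x s‖ ^ 2 / 2 + (p x s) ^ 2 / (2 * K)))
        (-(1 / Re) * ∫ x : E3, frobSq (fderiv ℝ (fun y => v y t) x)) t ∧
      -(1 / Re) * (∫ x : E3, frobSq (fderiv ℝ (fun y => v y t) x)) ≤ 0) ∧
    Antitone (fun t : ℝ => ∫ x : E3, (‖v x t‖ ^ 2 / 2 + (p x t) ^ 2 / (2 * K))) := by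
  have hG : GSol (1 / Re) K (co v) (fun z => p z.1 z.2) := by
    refine ⟨co_smooth hv, hp, ?_, ?_⟩
    · rintro i ⟨x, t⟩
      have h := congrArg (fun w : E3 => w i) (hmom x t)
      simp only [PiLp.add_apply, PiLp.sub_apply, PiLp.neg_apply, PiLp.smul_apply, smul_eq_mul] at h
      rw [deriv_co hv, adv_co hv, grad_co hp, lap_co hv, div_co hv] at h
      have hc : v x t i = co v i (x, t) := rfl
      rw [hc] at h
      unfold g0 NL
      simp only [Fin.sum_univ_three] at h ⊢
      linear_combination h
    · rintro ⟨x, t⟩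
      have h := hmass x t
      rw [div_co hv] at h
      have h2 : deriv (fun s => p x s) t = Dv et (fun z => p z.1 z.2) (x, t) :=
        (hasDerivAt_time (hp.differentiable (by simp)) x t).deriv
      rw [h2] at h
      field_simp at h
      linear_combination h
  have hT : ∀ t, ∃ n, t ∈ TT (co v) (fun z => p z.1 z.2) n := by
    intro t
    obtain ⟨r1, h1⟩ := (hvsupp t).isCompact.isBounded.subset_closedBall 0
    obtain ⟨r2, h2⟩ := (hpsupp t).isCompact.isBounded.subset_closedBall 0
    obtain ⟨n, hn⟩ := exists_nat_ge (max r1 r2)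
    have := le_max_left r1 r2
    have := le_max_right r1 r2
    refine ⟨n, fun x hx => ⟨fun i => ?_, ?_⟩⟩
    · have : v x t = 0 := by
        by_contra hne
        have := h1 (subset_tsupport _ (show x ∈ Function.support fun x => v x t from hne))
        rw [mem_closedBall_zero_iff] at this
        linarith
      simp [co, this]
    · by_contra hne
      have := h2 (subset_tsupport _ (show x ∈ Function.support fun x => p x t from hne))
      rw [mem_closedBall_zero_iff] at this
      linarith
  have hen : ∀ s x, en K (co v) (fun z => p z.1 z.2) (x, s) =
      ‖v x s‖ ^ 2 / 2 + (p x s) ^ 2 / (2 * K) := by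
    intro s x
    rw [EuclideanSpace.real_norm_sq_eq]
    simp only [en, co, Fin.sum_univ_three]
    ring
  have hds : ∀ t x, ds (co v) (x, t) = frobSq (fderiv ℝ (fun y => v y t) x) := by
    intro t x
    unfold ds frobSq
    simp only [fderiv_co hv, sq]
  have hD := hG.energy (by positivity) hK hT
  simp only [hen, hds] at hD
  have hle : ∀ t, -(1 / Re) * (∫ x : E3, frobSq (fderiv ℝ (fun y => v y t) x)) ≤ 0 := by
    intro t
    have h1 : 0 ≤ ∫ x : E3, frobSq (fderiv ℝ (fun y => v y t) x) :=
      integral_nonneg fun x => by unfold frobSq; positivity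
    have h2 : 0 < 1 / Re := by positivity
    nlinarith
  exact ⟨fun t => ⟨hD t, hle t⟩, antitone_of_hasDerivAt_nonpos hD hle⟩
end
end
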